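/- arXiv:1805.08851 — 3 statements merged into one kernel-verified Lean document; each statement's English description precedes it below -/
import Mathlib

section
/- Let K be a number field with ring of integers O_K, and let a, b, c, e ∈ O_K generate four pairwise distinct prime ideals of O_K and satisfy: (1) a ≡ 1 mod 8·O_K and σ(a) > 0 for every real embedding σ : K → ℝ; (2) b ≡ 1 mod 2a·O_K; (3) c ≡ 1 mod 2·O_K and c is not congruent to a square of an element of O_K modulo the prime ideal (a); (4) e is not congruent to a square of an element of O_K modulo the prime ideal (a). Then: a is congruent to a square of an element of O_K modulo the prime ideal (b); a is not congruent to a square of an element of O_K modulo the prime ideal (c); and b·c·e is congruent to a square of an element of O_K modulo the prime ideal (a). -/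
open NumberField

/-- `f` has mean value `m` if a suitable finite average of its translates is constant,
equal to `m`. -/
def HasMean {A : Type*} [AddCommGroup A] (f : A → ℂ) (m : ℂ) : Prop :=
  ∃ (n : ℕ) (s : Fin n → A), 0 < n ∧ ∀ x, ∑ i, f (x + s i) = n * m

namespace HasMean

variable {A B : Type*} [AddCommGroup A] [AddCommGroup B]

theorem of_fintype {ι : Type*} [Fintype ι] [Nonempty ι] {f : A → ℂ} {m : ℂ} (s : ι → A)
    (h : ∀ x, ∑ i, f (x + s i) = Fintype.card ι * m) : HasMean f m := by
  refine ⟨Fintype.card ι, s ∘ (Fintype.equivFin ι).symm, Fintype.card_pos, fun x => ?_⟩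
  rw [← h x]
  exact (Fintype.equivFin ι).symm.sum_comp (fun i => f (x + s i))

theorem unique {f : A → ℂ} {m m' : ℂ} (h : HasMean f m) (h' : HasMean f m') : m = m' := by
  obtain ⟨n, s, hn, hs⟩ := h
  obtain ⟨n', s', hn', hs'⟩ := h'
  have h1 : ∑ j, ∑ i, f (s' j + s i) = n' * (n * m) := by simp [hs]
  have h2 : ∑ j, ∑ i, f (s' j + s i) = n * (n' * m') := by
    have h3 : ∀ i, ∑ j, f (s' j + s i) = n' * m' := fun i => by
      rw [← hs' (s i)]
      exact Finset.sum_congr rfl fun j _ => by rw [add_comm]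
    rw [Finset.sum_comm]
    simp [h3]
  have hn0 : (n : ℂ) ≠ 0 := by exact_mod_cast hn.ne'
  have hn0' : (n' : ℂ) ≠ 0 := by exact_mod_cast hn'.ne'
  have h3 := h1.symm.trans h2
  rw [mul_left_comm] at h3
  exact mul_left_cancel₀ hn0' (mul_left_cancel₀ hn0 h3)

theorem const (m : ℂ) : HasMean (fun _ : A => m) m :=
  ⟨1, 0, one_pos, fun _ => by simp⟩

theorem congr {f g : A → ℂ} {m : ℂ} (h : HasMean f m) (hfg : ∀ x, f x = g x) : HasMean g m := by
  rwa [← funext hfg]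

/-- Pulling back along a homomorphism that is surjective modulo periods preserves the mean. -/
theorem comp {f : B → ℂ} {m : ℂ} (h : HasMean f m) (φ : A →+ B)
    (hφ : ∀ b, ∃ a, ∀ x, f (x + b) = f (x + φ a)) : HasMean (fun x => f (φ x)) m := by
  obtain ⟨n, s, hn, hs⟩ := h
  choose t ht using hφ
  exact ⟨n, t ∘ s, hn, fun x => by
    rw [← hs (φ x)]
    exact Finset.sum_congr rfl fun i _ => (congrArg f (map_add φ _ _)).trans (ht _ _).symm⟩

theorem comp_of_surjective {f : B → ℂ} {m : ℂ} (h : HasMean f m) (φ : A →+ B)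
    (hφ : Function.Surjective φ) : HasMean (fun x => f (φ x)) m :=
  h.comp φ fun b => (hφ b).imp fun a ha x => by rw [ha]

theorem prod {f : A → ℂ} {g : B → ℂ} {m m' : ℂ} (h : HasMean f m) (h' : HasMean g m') :
    HasMean (fun p : A × B => f p.1 * g p.2) (m * m') := by
  obtain ⟨n, s, hn, hs⟩ := h
  obtain ⟨n', s', hn', hs'⟩ := h'
  have := Fin.pos_iff_nonempty.1 hn
  have := Fin.pos_iff_nonempty.1 hn'
  refine of_fintype (ι := Fin n × Fin n') (fun i => (s i.1, s' i.2)) fun x => ?_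
  simp only [Prod.fst_add, Prod.snd_add, Fintype.sum_prod_type, ← Finset.mul_sum,
    ← Finset.sum_mul, hs, hs', Fintype.card_prod, Fintype.card_fin]
  push_cast; ring

theorem pi {ι : Type*} [Fintype ι] {f : ι → A → ℂ} {m : ι → ℂ}
    (h : ∀ i, HasMean (f i) (m i)) : HasMean (fun k : ι → A => ∏ i, f i (k i)) (∏ i, m i) := by
  classical
  choose n s hn hs using h
  have := fun i => Fin.pos_iff_nonempty.1 (hn i)
  refine of_fintype (ι := ∀ i, Fin (n i)) (fun k i => s i (k i)) fun x => ?_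
  have := Finset.prod_univ_sum (fun i => (Finset.univ : Finset (Fin (n i))))
    (fun i j => f i (x i + s i j))
  simp only [hs, Fintype.piFinset_univ] at this
  simp only [Pi.add_apply, ← this, Finset.prod_mul_distrib]
  simp

theorem translates {ι : Type*} [Fintype ι] [Nonempty ι] {f g : A → ℂ} {m : ℂ} (h : HasMean f m)
    (s : ι → A) (hg : ∀ x, ∑ i, f (x + s i) = Fintype.card ι * g x) : HasMean g m := by
  obtain ⟨n, t, hn, ht⟩ := h
  refine ⟨n, t, hn, fun x => ?_⟩
  have h0 : (Fintype.card ι : ℂ) ≠ 0 := by exact_mod_cast Fintype.card_ne_zero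
  apply mul_left_cancel₀ h0
  rw [Finset.mul_sum]
  simp_rw [← hg]
  rw [Finset.sum_comm]
  simp_rw [add_right_comm x _ (s _), ht]
  simp

theorem extend_by_zero {f : A → ℂ} {m : ℂ} (C : AddSubgroup A) [Finite (A ⧸ C)] [DecidablePred (· ∈ C)]
    (h : HasMean (fun x : C => f x) m) :
    HasMean (fun x => if x ∈ C then f x else 0) (m / Nat.card (A ⧸ C)) := by
  obtain ⟨n, t, hn, ht⟩ := h
  have := Fin.pos_iff_nonempty.1 hn
  have := Fintype.ofFinite (A ⧸ C)
  refine of_fintype (ι := (A ⧸ C) × Fin n) (fun i => i.1.out + t i.2) fun x => ?_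
  have key : ∀ y : A, ∑ i, (if y + (t i : A) ∈ C then f (y + (t i : A)) else 0) = if y ∈ C then n * m else 0 := by
    intro y
    simp only [C.add_mem_cancel_right (t _).2]
    split_ifs with hy
    · exact ht ⟨y, hy⟩
    · simp
  simp only [Fintype.sum_prod_type, ← add_assoc, key]
  have : ∀ q : A ⧸ C, x + q.out ∈ C ↔ q = (-x : A) := by
    intro q
    conv_rhs => rw [← QuotientAddGroup.out_eq' q]
    rw [eq_comm, QuotientAddGroup.eq]
    simp
  simp only [this, Finset.sum_ite_eq', Finset.mem_univ, if_true, Fintype.card_prod,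
    Fintype.card_fin, Nat.card_eq_fintype_card]
  have h0 : (Fintype.card (A ⧸ C) : ℂ) ≠ 0 := by exact_mod_cast Fintype.card_ne_zero
  push_cast
  field_simp

theorem addChar_eq_zero {χ : A → ℂ} {m : ℂ} (h : HasMean χ m) (hχ : ∀ x y, χ (x + y) = χ x * χ y)
    {a : A} (ha : χ a ≠ 1) : m = 0 := by
  have h1 : HasMean χ (χ a * m) := by
    obtain ⟨n, s, hn, hs⟩ := h
    refine ⟨n, fun i => a + s i, hn, fun x => ?_⟩
    simp_rw [← add_assoc, add_right_comm x a, hχ _ a, ← Finset.sum_mul, hs]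
    ring
  have := h.unique h1
  by_contra hm
  exact ha (mul_right_cancel₀ hm (by rw [← this, one_mul]))

end HasMean

/-- In a finitely generated group, one finite family averages all `N`-periodic functions. -/
theorem exists_averaging_family (A : Type*) [AddCommGroup A] [AddGroup.FG A] {N : ℕ} (hN : 0 < N) :
    ∃ (n : ℕ) (s : Fin n → A), 0 < n ∧
      ∀ f : A → ℂ, (∀ x y, f (x + N • y) = f x) → ∃ m, ∀ x, ∑ i, f (x + s i) = n * m := by
  let P : AddSubgroup A := (nsmulAddMonoidHom N : A →+ A).range
  have hfin : Finite (A ⧸ P) := by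
    have : AddGroup.FG (A ⧸ P) := QuotientAddGroup.fg P
    refine AddCommGroup.finite_of_fg_isAddTorsion _ fun q => ?_
    obtain ⟨x, rfl⟩ := QuotientAddGroup.mk_surjective q
    rw [isOfFinAddOrder_iff_nsmul_eq_zero]
    exact ⟨N, hN, (QuotientAddGroup.eq_zero_iff _).2 ⟨x, rfl⟩⟩
  have := Fintype.ofFinite (A ⧸ P)
  refine ⟨Fintype.card (A ⧸ P), fun i => ((Fintype.equivFin _).symm i).out, Fintype.card_pos,
    fun f hf => ⟨(∑ q : A ⧸ P, f q.out) / Fintype.card (A ⧸ P), fun x => ?_⟩⟩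
  rw [(Fintype.equivFin (A ⧸ P)).symm.sum_comp (fun q => f (x + q.out))]
  rw [mul_div_cancel₀ _ (by exact_mod_cast Fintype.card_ne_zero)]
  refine Eq.trans ?_ (Equiv.sum_comp (Equiv.addLeft (x : A ⧸ P)) (fun q => f q.out))
  refine Finset.sum_congr rfl fun q _ => ?_
  have : ((((x : A ⧸ P) + q).out : A) : A ⧸ P) = ((x + q.out : A) : A ⧸ P) := by
    simp
  obtain ⟨y, hy⟩ := QuotientAddGroup.eq.1 this
  have h2 : x + q.out = ((x : A ⧸ P) + q).out + N • y := by
    have : N • y = -((x : A ⧸ P) + q).out + (x + q.out) := hy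
    rw [this]; abel
  rw [h2, hf]; rfl

theorem exists_hasMean {A : Type*} [AddCommGroup A] [AddGroup.FG A] {N : ℕ} (hN : 0 < N)
    {f : A → ℂ} (hf : ∀ x y, f (x + N • y) = f x) : ∃ m, HasMean f m := by
  obtain ⟨n, s, hn, hs⟩ := exists_averaging_family A hN
  obtain ⟨m, hm⟩ := hs f hf
  exact ⟨m, n, s, hn, hm⟩

section Theta
open Complex Filter Topology Real

theorem tendsto_sqrt_mul_evenKernel (r : ℝ) :
    Tendsto (fun ε : ℝ => √ε * HurwitzZeta.evenKernel r ε) (𝓝[>] 0) (𝓝 1) := by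
  obtain ⟨p, hp, h⟩ := HurwitzZeta.isBigO_atTop_cosKernel_sub (r : UnitAddCircle)
  have h1 : Tendsto (fun x => HurwitzZeta.cosKernel (r : UnitAddCircle) x - 1) atTop (𝓝 0) := by
    refine h.trans_tendsto ?_
    have : Tendsto (fun x : ℝ => -(p * x)) atTop atBot :=
      tendsto_neg_atTop_atBot.comp (tendsto_id.const_mul_atTop hp)
    simpa only [Function.comp_def, neg_mul] using Real.tendsto_exp_atBot.comp this
  have h2 := (h1.comp tendsto_inv_nhdsGT_zero).add_const 1
  simp only [zero_add, Function.comp_def, sub_add_cancel] at h2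
  refine h2.congr' ?_
  filter_upwards [self_mem_nhdsWithin] with ε hε
  have hε : 0 < ε := hε
  rw [HurwitzZeta.evenKernel_functional_equation, ← Real.sqrt_eq_rpow, one_div, one_div,
    mul_inv_cancel_left₀ (Real.sqrt_ne_zero'.2 hε)]

/-- Theta series detect the mean value of a periodic function. -/
theorem tendsto_sqrt_mul_tsum {N : ℕ} (hN : 0 < N) {f : ℤ → ℂ} (hf : ∀ k, f (k + N) = f k) :
    Tendsto (fun ε : ℝ => √ε * ∑' k : ℤ, f k * rexp (-π * k ^ 2 * ε)) (𝓝[>] 0)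
      (𝓝 ((∑ r : Fin N, f r) / N)) := by
  have hN0 : (0 : ℝ) < N := by exact_mod_cast hN
  have hf' : ∀ (j : ℤ) (r : ℤ), f (r + j * N) = f r := by
    intro j
    induction j using Int.induction_on with
    | zero => simp
    | succ i ih => intro r; rw [add_mul, one_mul, ← add_assoc, hf, ih]
    | pred i ih => intro r; rw [← ih r, ← hf]; congr 1; ring
  have key : ∀ ε : ℝ, 0 < ε → ∑' k : ℤ, f k * rexp (-π * k ^ 2 * ε) =
      ∑ r : Fin N, f r * HurwitzZeta.evenKernel (((r : ℝ) / N : ℝ) : UnitAddCircle) (N ^ 2 * ε) := by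
    intro ε hε
    have : NeZero N := ⟨hN.ne'⟩
    have hs : ∀ r : Fin N, HasSum (fun j : ℤ => f (r + j * N) *
        rexp (-π * ((r + j * N : ℤ) : ℝ) ^ 2 * ε))
        (f r * HurwitzZeta.evenKernel (((r : ℝ) / N : ℝ) : UnitAddCircle) (N ^ 2 * ε)) := by
      intro r
      have := (Complex.hasSum_ofReal.2 (HurwitzZeta.hasSum_int_evenKernel ((r : ℝ) / N)
        (t := N ^ 2 * ε) (by positivity))).mul_left (f r)
      refine this.congr_fun fun j => ?_
      rw [hf']
      congr 3
      push_cast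
      field_simp
      ring
    have hs' : ∀ r : Fin N, HasSum (fun p : ℤ × Fin N => if p.2 = r then f (r + p.1 * N) *
        rexp (-π * ((r + p.1 * N : ℤ) : ℝ) ^ 2 * ε) else 0)
        (f r * HurwitzZeta.evenKernel (((r : ℝ) / N : ℝ) : UnitAddCircle) (N ^ 2 * ε)) := by
      intro r
      have hinj : Function.Injective fun j : ℤ => (j, r) := fun _ _ h => congrArg Prod.fst h
      rw [← hinj.hasSum_iff]
      · simpa [Function.comp_def] using hs r
      · rintro ⟨j, r'⟩ h
        exact if_neg fun hr => h ⟨j, by simp [← hr]⟩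
    have hs'' := hasSum_sum (s := Finset.univ) fun r _ => hs' r
    rw [← (Int.divModEquiv N).symm.tsum_eq, ← hs''.tsum_eq]
    refine tsum_congr fun p => ?_
    simp [Int.divModEquiv_symm_apply, add_comm, mul_comm]
  have hlim : Tendsto (fun ε : ℝ => ∑ r : Fin N, f r / N *
      ((√(N ^ 2 * ε) * HurwitzZeta.evenKernel (((r : ℝ) / N : ℝ) : UnitAddCircle) (N ^ 2 * ε) : ℝ) : ℂ))
      (𝓝[>] 0) (𝓝 (∑ r : Fin N, f r / N * (1 : ℝ))) := by
    refine tendsto_finsetSum _ fun r _ => Tendsto.const_mul _ ?_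
    refine (Complex.continuous_ofReal.tendsto _).comp
      ((tendsto_sqrt_mul_evenKernel _).comp ?_)
    refine tendsto_nhdsWithin_iff.2 ⟨?_, ?_⟩
    · have : Tendsto (fun ε : ℝ => (N : ℝ) ^ 2 * ε) (𝓝 0) (𝓝 (N ^ 2 * 0)) :=
        (continuous_const.mul continuous_id).tendsto 0
      rw [mul_zero] at this
      exact this.mono_left nhdsWithin_le_nhds
    · filter_upwards [self_mem_nhdsWithin] with ε hε
      have hε : 0 < ε := hε
      exact Set.mem_Ioi.2 (by positivity)
  rw [Finset.sum_div]
  simp only [Complex.ofReal_one, mul_one] at hlim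
  refine hlim.congr' ?_
  filter_upwards [self_mem_nhdsWithin] with ε hε
  rw [key ε hε, Finset.mul_sum]
  refine Finset.sum_congr rfl fun r _ => ?_
  rw [Real.sqrt_mul (by positivity), Real.sqrt_sq hN0.le]
  push_cast
  have : (N : ℂ) ≠ 0 := by exact_mod_cast hN.ne'
  field_simp

theorem cpow_half_ofReal_mul {r : ℝ} (hr : 0 < r) {z : ℂ} (hz : z ≠ 0) :
    ((r : ℂ) * z) ^ (1 / 2 : ℂ) = √r * z ^ (1 / 2 : ℂ) := by
  have hr' : (r : ℂ) ≠ 0 := by exact_mod_cast hr.ne'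
  rw [cpow_def_of_ne_zero (mul_ne_zero hr' hz), cpow_def_of_ne_zero hz, log_ofReal_mul hr hz,
    add_mul, Complex.exp_add, ← Real.exp_log (Real.sqrt_pos.2 hr), Real.log_sqrt hr.le]
  push_cast
  rw [mul_one_div]

theorem tendsto_jacobiTheta_of_tendsto_im {α : Type*} {l : Filter α} {τ : α → ℂ}
    (h : Tendsto (fun x => (τ x).im) l atTop) : Tendsto (fun x => jacobiTheta (τ x)) l (𝓝 1) := by
  have h1 : Tendsto (fun τ => jacobiTheta τ - 1) (comap im atTop) (𝓝 0) := by
    refine isBigO_at_im_infty_jacobiTheta_sub_one.trans_tendsto ?_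
    refine Real.tendsto_exp_atBot.comp ?_
    exact tendsto_comap.const_mul_atTop_of_neg (by simp [pi_pos])
  simpa using (h1.comp (tendsto_comap_iff.2 h)).add_const 1

theorem jacobiTheta_add_two_mul_nat (τ : ℂ) (n : ℕ) :
    jacobiTheta (τ + 2 * n) = jacobiTheta τ := by
  induction n with
  | zero => simp
  | succ n ih => rw [← ih, ← jacobiTheta_two_add (τ + 2 * n)]; congr 1; push_cast; ring

theorem jacobiTheta_functional_equation (τ : ℂ) :
    jacobiTheta τ = 1 / (-I * τ) ^ (1 / 2 : ℂ) * jacobiTheta (-1 / τ) := by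
  simp only [jacobiTheta_eq_jacobiTheta₂]
  rw [jacobiTheta₂_functional_equation 0 τ]
  simp

/-- The limit computed through the functional equation of Jacobi's theta function. -/
theorem tendsto_sqrt_mul_tsum_gauss {d : ℕ} (hd : 0 < d) :
    Tendsto (fun ε : ℝ => √ε * ∑' k : ℤ, cexp (2 * π * I * (k ^ 2 / (4 * d))) *
      rexp (-π * k ^ 2 * ε)) (𝓝[>] 0) (𝓝 ((√(2 * d))⁻¹ * cexp (2 * π * I / 8))) := by
  have hd0 : (0 : ℝ) < d := by exact_mod_cast hd
  have hd1 : (d : ℂ) ≠ 0 := by exact_mod_cast hd.ne'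
  set τ : ℝ → ℂ := fun ε => (1 / (2 * d) : ℝ) + ε * I with hτ
  have hτ0 : ∀ ε, τ ε ≠ 0 := fun ε h => by
    have := congrArg re h
    simp [hτ] at this
    exact hd.ne' this
  have hlim : Tendsto τ (𝓝[>] 0) (𝓝 ((1 / (2 * d) : ℝ) : ℂ)) := by
    have : Continuous τ := by fun_prop
    have := this.tendsto 0
    simp only [hτ, ofReal_zero, zero_mul, add_zero] at this
    exact this.mono_left nhdsWithin_le_nhds
  have key : ∀ ε : ℝ, 0 < ε → √ε * ∑' k : ℤ, cexp (2 * π * I * (k ^ 2 / (4 * d))) *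
      rexp (-π * k ^ 2 * ε) = 1 / (-I * τ ε) ^ (1 / 2 : ℂ) * (1 / (√(2 * d) * (1 / τ ε) ^ (1 / 2 : ℂ)) *
        jacobiTheta (- (1 / (2 * d) : ℝ) + (1 / (4 * d ^ 2 * ε) : ℝ) * I)) := by
    intro ε hε
    have hε1 : (ε : ℂ) ≠ 0 := by exact_mod_cast hε.ne'
    have h1 : ∑' k : ℤ, cexp (2 * π * I * (k ^ 2 / (4 * d))) * rexp (-π * k ^ 2 * ε) =
        jacobiTheta (τ ε) := by
      refine tsum_congr fun k => ?_
      rw [ofReal_exp, ← Complex.exp_add]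
      congr 1
      simp only [hτ]
      push_cast
      field_simp
      ring_nf
      simp only [I_sq]
      ring
    have h2 : -1 / τ ε + 2 * d = (2 * d * ε : ℝ) * I * (1 / τ ε) := by
      have := hτ0 ε
      field_simp
      simp only [hτ]
      push_cast
      field_simp
      ring
    have h3 : -I * ((2 * d * ε : ℝ) * I * (1 / τ ε)) = (2 * d * ε : ℝ) * (1 / τ ε) := by
      linear_combination (-(2 * d * ε : ℝ) * (1 / τ ε)) * I_sq
    have h4 : -1 / ((2 * d * ε : ℝ) * I * (1 / τ ε)) =
        - (1 / (2 * d) : ℝ) + (1 / (4 * d ^ 2 * ε) : ℝ) * I := by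
      have := hτ0 ε
      field_simp
      simp only [hτ]
      push_cast
      field_simp
      ring_nf
      simp only [I_sq]
      ring
    rw [h1, jacobiTheta_functional_equation (τ ε), ← jacobiTheta_add_two_mul_nat _ d, h2,
      jacobiTheta_functional_equation (_ * _ * _), h3, h4,
      cpow_half_ofReal_mul (by positivity) (one_div_ne_zero (hτ0 ε)), Real.sqrt_mul (by positivity)]
    have : (√ε : ℂ) ≠ 0 := by exact_mod_cast (Real.sqrt_pos.2 hε).ne'
    push_cast
    field_simp
  have hth : Tendsto (fun ε : ℝ => jacobiTheta (- (1 / (2 * d) : ℝ) + (1 / (4 * d ^ 2 * ε) : ℝ) * I))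
      (𝓝[>] 0) (𝓝 1) := by
    apply tendsto_jacobiTheta_of_tendsto_im
    have : Tendsto (fun ε : ℝ => 1 / (4 * (d : ℝ) ^ 2) * ε⁻¹) (𝓝[>] 0) atTop :=
      tendsto_inv_nhdsGT_zero.const_mul_atTop (by positivity)
    refine this.congr fun ε => ?_
    rw [add_im, ← ofReal_neg, ofReal_im, im_ofReal_mul, I_im]
    field_simp
    try ring
  have hA : Tendsto (fun ε => (-I * τ ε) ^ (1 / 2 : ℂ)) (𝓝[>] 0)
      (𝓝 ((-I * (1 / (2 * d) : ℝ)) ^ (1 / 2 : ℂ))) := by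
    refine (continuousAt_cpow_const ?_).tendsto.comp (hlim.const_mul (-I))
    right
    simpa using hd1
  have hB : Tendsto (fun ε => (1 / τ ε) ^ (1 / 2 : ℂ)) (𝓝[>] 0)
      (𝓝 ((2 * d : ℝ) ^ (1 / 2 : ℂ))) := by
    have : ((2 * d : ℝ) : ℂ) = 1 / ((1 / (2 * d) : ℝ) : ℂ) := by push_cast; field_simp
    rw [this]
    refine (continuousAt_cpow_const ?_).tendsto.comp (tendsto_const_nhds.div hlim ?_)
    · rw [← this]
      exact Or.inl (by simpa using hd0)
    · exact_mod_cast (by positivity : (1 / (2 * d) : ℝ) ≠ 0)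
  have e1 : (-I * (1 / (2 * d) : ℝ)) ^ (1 / 2 : ℂ) = (√(2 * d))⁻¹ * cexp (-(2 * π * I / 8)) := by
    rw [mul_comm, cpow_half_ofReal_mul (by positivity) (by simp), one_div, Real.sqrt_inv,
      cpow_def_of_ne_zero (by simp), log_neg_I]
    push_cast
    congr 2
    ring
  have e2 : ((2 * d : ℝ) : ℂ) ^ (1 / 2 : ℂ) = √(2 * d) := by
    rw [Real.sqrt_eq_rpow, ofReal_cpow (by positivity)]
    norm_num
  rw [e1] at hA
  rw [e2] at hB
  have hs : ((√(2 * d) : ℝ) : ℂ) ≠ 0 := by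
    exact_mod_cast (Real.sqrt_pos.2 (by positivity)).ne'
  have hs' : ((((√(2 * d))⁻¹ : ℝ) : ℂ) * cexp (-(2 * π * I / 8))) ≠ 0 :=
    mul_ne_zero (by rw [ofReal_inv]; exact inv_ne_zero hs) (Complex.exp_ne_zero _)
  have hfin := ((tendsto_const_nhds (x := (1 : ℂ))).div hA hs').mul
    (((tendsto_const_nhds (x := (1 : ℂ))).div (hB.const_mul (√(2 * d) : ℂ))
      (mul_ne_zero hs hs)).mul hth)
  have heq : 1 / ((((√(2 * d))⁻¹ : ℝ) : ℂ) * cexp (-(2 * π * I / 8))) * (1 / ((√(2 * d) : ℂ) * √(2 * d)) * 1)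
      = (((√(2 * d))⁻¹ : ℝ) : ℂ) * cexp (2 * π * I / 8) := by
    rw [Complex.exp_neg, ofReal_inv]
    have := Complex.exp_ne_zero (2 * π * I / 8)
    field_simp
  rw [heq] at hfin
  refine hfin.congr' ?_
  filter_upwards [self_mem_nhdsWithin] with ε hε
  exact (key ε hε).symm

end Theta

/-- The additive character `q ↦ exp (2πiq)` of `ℚ`. -/
noncomputable def expQ (q : ℚ) : ℂ := Complex.exp (2 * Real.pi * Complex.I * q)

theorem expQ_add (x y : ℚ) : expQ (x + y) = expQ x * expQ y := by
  rw [expQ, expQ, expQ, ← Complex.exp_add]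
  push_cast; ring_nf

@[simp] theorem expQ_zero : expQ 0 = 1 := by simp [expQ]

/-- The subgroup `ℤ` of `ℚ`. -/
def ratInt : AddSubgroup ℚ := (Int.castAddHom ℚ).range

theorem mem_ratInt {q : ℚ} : q ∈ ratInt ↔ ∃ n : ℤ, q = n :=
  ⟨fun ⟨n, h⟩ => ⟨n, h.symm⟩, fun ⟨n, h⟩ => ⟨n, h.symm⟩⟩

@[simp] theorem intCast_mem_ratInt (n : ℤ) : (n : ℚ) ∈ ratInt := ⟨n, rfl⟩

theorem mul_mem_ratInt {x y : ℚ} (hx : x ∈ ratInt) (hy : y ∈ ratInt) : x * y ∈ ratInt := by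
  obtain ⟨n, rfl⟩ := mem_ratInt.1 hx
  obtain ⟨m, rfl⟩ := mem_ratInt.1 hy
  exact_mod_cast intCast_mem_ratInt (n * m)

theorem expQ_eq_one_iff {q : ℚ} : expQ q = 1 ↔ q ∈ ratInt := by
  rw [expQ, Complex.exp_eq_one_iff, mem_ratInt]
  refine exists_congr fun n => ?_
  have : (2 * (Real.pi : ℂ) * Complex.I) ≠ 0 := Complex.two_pi_I_ne_zero
  rw [mul_comm (n : ℂ)]
  constructor
  · intro h; exact_mod_cast mul_left_cancel₀ this h
  · rintro rfl; simp

theorem expQ_congr {x y : ℚ} (h : x - y ∈ ratInt) : expQ x = expQ y := by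
  rw [← sub_add_cancel x y, expQ_add, expQ_eq_one_iff.2 h, one_mul]

theorem expQ_neg (x : ℚ) : expQ (-x) = (starRingEnd ℂ) (expQ x) := by
  rw [expQ, expQ, ← Complex.exp_conj]
  simp [Complex.conj_ofNat]

theorem expQ_sum {ι : Type*} (s : Finset ι) (f : ι → ℚ) :
    expQ (∑ i ∈ s, f i) = ∏ i ∈ s, expQ (f i) := by
  induction s using Finset.cons_induction with
  | empty => simp
  | cons a s ha ih => rw [Finset.sum_cons, Finset.prod_cons, expQ_add, ih]

theorem sum_fin_add_eq_of_periodic {N : ℕ} {f : ℤ → ℂ} (hf : ∀ k, f (k + N) = f k) (x : ℤ) :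
    ∑ r : Fin N, f (x + r) = ∑ r : Fin N, f r := by
  have h (y : ℤ) : ∑ r : Fin N, f (y + 1 + r) = ∑ r : Fin N, f (y + r) := by
    have h1 := Finset.sum_range_succ (fun i : ℕ => f (y + i)) N
    rw [Finset.sum_range_succ', hf] at h1
    simp only [Nat.cast_zero, add_zero, add_left_inj] at h1
    rw [Fin.sum_univ_eq_sum_range (fun i => f (y + 1 + i)),
      Fin.sum_univ_eq_sum_range (fun i => f (y + i)), ← h1]
    refine Finset.sum_congr rfl fun i _ => ?_
    congr 1; push_cast; ring
  induction x using Int.induction_on with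
  | zero => simp
  | succ i ih => rw [h, ih]
  | pred i ih => rw [← ih, ← h, sub_add_cancel]

theorem HasMean.of_periodic {N : ℕ} (hN : 0 < N) {f : ℤ → ℂ} (hf : ∀ k, f (k + N) = f k) :
    HasMean f ((∑ r : Fin N, f r) / N) :=
  ⟨N, fun r => r, hN, fun x => by
    rw [sum_fin_add_eq_of_periodic hf, mul_div_cancel₀ _ (by exact_mod_cast hN.ne')]⟩

theorem HasMean.conj {A : Type*} [AddCommGroup A] {f : A → ℂ} {m : ℂ} (h : HasMean f m) :
    HasMean (fun x => (starRingEnd ℂ) (f x)) ((starRingEnd ℂ) m) := by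
  obtain ⟨n, s, hn, hs⟩ := h
  exact ⟨n, s, hn, fun x => by rw [← map_sum, hs]; simp⟩

theorem hasMean_gauss_of_pos {d : ℕ} (hd : 0 < d) :
    HasMean (fun k : ℤ => expQ (k ^ 2 / (4 * d))) (((√(2 * d))⁻¹ : ℝ) * expQ (1 / 8)) := by
  have hd' : (d : ℚ) ≠ 0 := by exact_mod_cast hd.ne'
  have hper (k : ℤ) : expQ ((k + (2 * d : ℕ) : ℤ) ^ 2 / (4 * d)) = expQ ((k : ℚ) ^ 2 / (4 * d)) := by
    refine expQ_congr (mem_ratInt.2 ⟨k + d, ?_⟩)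
    push_cast
    field_simp
    ring
  have h0 : 0 < 2 * d := by positivity
  have h := HasMean.of_periodic h0 (f := fun k : ℤ => expQ (k ^ 2 / (4 * d))) hper
  have h1 := tendsto_sqrt_mul_tsum h0 (f := fun k : ℤ => expQ (k ^ 2 / (4 * d))) hper
  have h2 := tendsto_sqrt_mul_tsum_gauss hd
  have h3 : (fun ε : ℝ => (√ε : ℂ) * ∑' k : ℤ, expQ ((k : ℚ) ^ 2 / (4 * d)) *
      Real.exp (-Real.pi * k ^ 2 * ε)) = fun ε : ℝ => (√ε : ℂ) * ∑' k : ℤ,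
      Complex.exp (2 * Real.pi * Complex.I * (k ^ 2 / (4 * d))) *
        Real.exp (-Real.pi * k ^ 2 * ε) := by
    ext ε
    simp [expQ]
  rw [h3] at h1
  rw [tendsto_nhds_unique h1 h2] at h
  convert h using 2
  simp only [expQ]; push_cast; ring_nf

theorem hasMean_gauss {d : ℤ} (hd : d ≠ 0) :
    HasMean (fun k : ℤ => expQ (k ^ 2 / (4 * d)))
      (((√(2 * |(d : ℝ)|))⁻¹ : ℝ) * expQ (SignType.sign d / 8)) := by
  rcases hd.lt_or_gt with h | h
  · obtain ⟨n, rfl⟩ : ∃ n : ℕ, d = -n := ⟨(-d).toNat, by omega⟩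
    have := (hasMean_gauss_of_pos (d := n) (by omega)).conj
    simp only [← expQ_neg, map_mul, Complex.conj_ofReal] at this
    convert this using 2
    · congr 1; push_cast; rw [mul_neg, div_neg]
    · simp
    · rw [sign_neg h]; simp [neg_div]
  · obtain ⟨n, rfl⟩ : ∃ n : ℕ, d = n := ⟨d.toNat, by omega⟩
    have := hasMean_gauss_of_pos (d := n) (by omega)
    rw [sign_pos h]
    simpa using this

section Signature

open Module QuadraticMap

/-- The bilinear form `(x, y) ↦ l (t * (x * y))`. -/
noncomputable def mulForm {F R : Type*} [Field F] [CommRing R] [Algebra F R] (l : R →ₗ[F] F)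
    (t : R) : LinearMap.BilinForm F R :=
  (LinearMap.mul F R).compr₂ (l ∘ₗ LinearMap.mulLeft F t)

@[simp] theorem mulForm_apply {F R : Type*} [Field F] [CommRing R] [Algebra F R] (l : R →ₗ[F] F)
    (t x y : R) : mulForm l t x y = l (t * (x * y)) := rfl

theorem mulForm_comm {F R : Type*} [Field F] [CommRing R] [Algebra F R] (l : R →ₗ[F] F)
    (t x y : R) : mulForm l t x y = mulForm l t y x := by
  simp [mul_comm x y]

theorem exists_sq_eq_mixedEmbedding {K : Type*} [Field K] {a : K} (ha : ∀ σ : K →+* ℝ, 0 < σ a) :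
    ∃ c, mixedEmbedding K a = c * c := by
  have hr (w : {w : InfinitePlace K // w.IsReal}) : ∃ c : ℝ, (mixedEmbedding K a).1 w = c * c := by
    rw [mixedEmbedding.mixedEmbedding_apply_isReal]
    exact ⟨_, (Real.mul_self_sqrt (ha _).le).symm⟩
  have hc (w : {w : InfinitePlace K // w.IsComplex}) :
      ∃ c : ℂ, (mixedEmbedding K a).2 w = c * c := IsAlgClosed.exists_eq_mul_self _
  choose c hc' using hr
  choose d hd using hc
  exact ⟨(c, d), Prod.ext (funext hc') (funext hd)⟩

variable {K : Type*} [Field K] [NumberField K]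

/-- An orthogonal basis of `K` for `(x, y) ↦ l (t * (x * y))` consisting of integers. -/
theorem exists_integral_orthogonal_basis {l : K →ₗ[ℚ] ℚ} (hl : l ≠ 0) {t : K} (ht : t ≠ 0) :
    ∃ v : Basis (Fin (finrank ℚ K)) ℚ K, (∀ i, IsIntegral ℤ (v i)) ∧
      (∀ i j, i ≠ j → l (t * (v i * v j)) = 0) ∧ ∀ i, l (t * (v i * v i)) ≠ 0 := by
  classical
  have : Invertible (2 : ℚ) := invertibleOfNonzero two_ne_zero
  obtain ⟨v, hv⟩ := LinearMap.BilinForm.exists_orthogonal_basis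
    (B := mulForm l t) ⟨mulForm_comm l t⟩
  have hsep : (mulForm l t).SeparatingLeft := by
    intro x hx
    by_contra h0
    apply hl
    ext y
    simpa [mul_inv_cancel_left₀ h0, mul_inv_cancel_left₀ ht, mul_assoc]
      using hx (x⁻¹ * (t⁻¹ * y))
  have hne := hv.not_isOrtho_basis_self_of_separatingLeft hsep
  obtain ⟨y, hy, hint⟩ := exists_integral_multiples ℤ ℚ (Finset.univ.image v)
  have hy' : (y : ℚ) ≠ 0 := by exact_mod_cast hy
  refine ⟨v.unitsSMul fun _ => Units.mk0 _ hy', fun i => ?_, fun i j hij => ?_, fun i => ?_⟩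
  · rw [Basis.unitsSMul_apply]
    have := hint (v i) (by simp)
    rw [← Int.cast_smul_eq_zsmul ℚ] at this
    exact this
  · have : l (t * (v i * v j)) = 0 := hv hij
    simp [Basis.unitsSMul_apply, Units.smul_def, this]
  · have : l (t * (v i * v i)) ≠ 0 := hne i
    simp [Basis.unitsSMul_apply, Units.smul_def, this, hy]

/-- The `ℝ`-linear extension of `l` to the mixed space. -/
noncomputable def realExtension (l : K →ₗ[ℚ] ℚ) : mixedEmbedding.mixedSpace K →ₗ[ℝ] ℝ :=
  (mixedEmbedding.latticeBasis K).constr ℝ fun i => (l (integralBasis K i) : ℝ)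

theorem realExtension_mixedEmbedding (l : K →ₗ[ℚ] ℚ) (x : K) :
    realExtension l (mixedEmbedding K x) = l x := by
  conv_rhs => rw [← (integralBasis K).sum_repr x]
  rw [realExtension, Basis.constr_apply_fintype]
  simp [Basis.equivFun_apply, mixedEmbedding.latticeBasis_repr_apply]

theorem sigPos_mulForm_realExtension {l : K →ₗ[ℚ] ℚ} {t : K}
    (v : Basis (Fin (finrank ℚ K)) ℚ K) (hv : ∀ i j, i ≠ j → l (t * (v i * v j)) = 0)
    (hv' : ∀ i, l (t * (v i * v i)) ≠ 0) :
    sigPos (LinearMap.BilinMap.toQuadraticMap (mulForm (realExtension l) (mixedEmbedding K t))) =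
      {i | 0 < l (t * (v i * v i))}.ncard := by
  set B := mulForm (realExtension l) (mixedEmbedding K t) with hB
  have happ (x y : K) : B (mixedEmbedding K x) (mixedEmbedding K y) = l (t * (x * y)) := by
    rw [hB, mulForm_apply, ← map_mul, ← map_mul, realExtension_mixedEmbedding]
  have hortho : B.IsOrthoᵢ fun i => mixedEmbedding K (v i) := by
    intro i j hij
    change B _ _ = 0
    rw [happ, hv i j hij, Rat.cast_zero]
  have hli : LinearIndependent ℝ fun i => mixedEmbedding K (v i) := by
    refine LinearMap.linearIndependent_of_isOrthoᵢ hortho fun i hi => hv' i ?_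
    have : B _ _ = 0 := hi
    rw [happ] at this
    exact_mod_cast this
  let w : Basis (Fin (finrank ℝ (mixedEmbedding.mixedSpace K))) ℝ (mixedEmbedding.mixedSpace K) :=
    (Basis.mk hli (hli.span_eq_top_of_card_eq_finrank' (by
      rw [Fintype.card_fin, mixedEmbedding.finrank])).ge).reindex
      (finCongr (mixedEmbedding.finrank K).symm)
  have hw (i) : w i = mixedEmbedding K (v (finCongr (mixedEmbedding.finrank K) i)) := by
    simp [w]
  have hassoc : associated (R := ℝ) (LinearMap.BilinMap.toQuadraticMap B) = B :=
    associated_left_inverse ℝ (mulForm_comm _ _)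
  have := QuadraticForm.sigPos_of_equiv_weightedSumSquares
    ⟨QuadraticForm.isometryEquivWeightedSumSquares (LinearMap.BilinMap.toQuadraticMap B) w (by
      rw [hassoc]
      intro i j hij
      change B _ _ = 0
      rw [hw, hw]
      exact hortho fun h => hij (by simpa using h))⟩
  rw [this]
  have h2 : {i | 0 < (LinearMap.BilinMap.toQuadraticMap B) (w i)} =
      (finCongr (mixedEmbedding.finrank K)) ⁻¹' {i | 0 < l (t * (v i * v i))} := by
    ext i
    rw [Set.mem_ofPred_eq, LinearMap.BilinMap.toQuadraticMap_apply, hw, happ]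
    simp
  rw [h2, Set.ncard_preimage_of_injective_subset_range (Equiv.injective _) (by simp)]

/-- Totally positive factors do not change the signature. -/
theorem ncard_pos_eq_of_totally_positive {l : K →ₗ[ℚ] ℚ} {t a : K} (ha : ∀ σ : K →+* ℝ, 0 < σ a)
    (ha0 : a ≠ 0)
    (v : Basis (Fin (finrank ℚ K)) ℚ K) (hv : ∀ i j, i ≠ j → l (t * (v i * v j)) = 0)
    (hv' : ∀ i, l (t * (v i * v i)) ≠ 0)
    (w : Basis (Fin (finrank ℚ K)) ℚ K) (hw : ∀ i j, i ≠ j → l (t * a * (w i * w j)) = 0)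
    (hw' : ∀ i, l (t * a * (w i * w i)) ≠ 0) :
    {i | 0 < l (t * (v i * v i))}.ncard = {i | 0 < l (t * a * (w i * w i))}.ncard := by
  rw [← sigPos_mulForm_realExtension v hv hv', ← sigPos_mulForm_realExtension w hw hw']
  obtain ⟨c, hc⟩ := exists_sq_eq_mixedEmbedding ha
  obtain ⟨c', hc'⟩ : ∃ c', c * c' = 1 := by
    refine ⟨c * mixedEmbedding K a⁻¹, ?_⟩
    rw [← mul_assoc, ← hc, ← map_mul, mul_inv_cancel₀ ha0, map_one]
  refine (QuadraticMap.Equivalent.sigPos_eq ⟨⟨LinearEquiv.ofLinearMap (LinearMap.mulLeft ℝ c)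
    (LinearMap.mulLeft ℝ c') ?_ ?_, fun x => ?_⟩⟩).symm
  · refine LinearMap.ext fun x => ?_; simp [← mul_assoc, hc']
  · refine LinearMap.ext fun x => ?_; simp [← mul_assoc, mul_comm c' c, hc']
  · simp only [LinearMap.BilinMap.toQuadraticMap_apply, mulForm_apply, map_mul, hc]
    simp
    congr 1
    ring

end Signature

section Milgram

open Module

theorem AddSubgroup.fg_of_le_span {V ι : Type*} [AddCommGroup V] [Finite ι] {w : ι → V}
    {C : AddSubgroup V} (h : ∀ x ∈ C, x ∈ Submodule.span ℤ (Set.range w)) : AddGroup.FG C := by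
  have hN : (Submodule.span ℤ (Set.range w)).FG := Submodule.fg_span (Set.finite_range w)
  have : IsNoetherian ℤ (Submodule.span ℤ (Set.range w)) := isNoetherian_of_fg_of_noetherian _ hN
  have h2 : AddSubgroup.toIntSubmodule C ≤ Submodule.span ℤ (Set.range w) := h
  have h3 : (AddSubgroup.toIntSubmodule C).FG := Submodule.FG.of_le hN h2
  exact Module.Finite.iff_addGroup_fg.1 (Module.Finite.iff_fg.2 h3)

theorem finite_quotient_of_nsmul_mem {A : Type*} [AddCommGroup A] [AddGroup.FG A]
    {C : AddSubgroup A} {N : ℕ} (hN : 0 < N) (h : ∀ x : A, N • x ∈ C) : Finite (A ⧸ C) := by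
  have : AddGroup.FG (A ⧸ C) := QuotientAddGroup.fg C
  refine AddCommGroup.finite_of_fg_isAddTorsion _ fun q => ?_
  obtain ⟨x, rfl⟩ := QuotientAddGroup.mk_surjective q
  rw [isOfFinAddOrder_iff_nsmul_eq_zero]
  exact ⟨N, hN, (QuotientAddGroup.eq_zero_iff _).2 (h x)⟩

variable {K : Type*} [Field K]

theorem coe_mul_ringOfIntegers (x y : 𝓞 K) : ((x * y : 𝓞 K) : K) = x * y := map_mul _ _ _

theorem coe_add_ringOfIntegers (x y : 𝓞 K) : ((x + y : 𝓞 K) : K) = x + y := map_add _ _ _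

theorem exists_coe_eq_of_isIntegral {ι : Type*} {v : ι → K} (h : ∀ i, IsIntegral ℤ (v i)) :
    ∃ e : ι → 𝓞 K, ∀ i, v i = e i :=
  ⟨fun i => ⟨v i, h i⟩, fun _ => rfl⟩

variable [NumberField K] {l : K →ₗ[ℚ] ℚ}

/-- The dual lattice of `𝓞 K` with respect to `(x, y) ↦ l (x * y)`. -/
def dualLattice (l : K →ₗ[ℚ] ℚ) : Submodule (𝓞 K) K where
  carrier := {y | ∀ x : 𝓞 K, l (y * x) ∈ ratInt}
  zero_mem' x := by simp [ratInt.zero_mem]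
  add_mem' hy hz x := by rw [add_mul, map_add]; exact ratInt.add_mem (hy x) (hz x)
  smul_mem' c y hy x := by
    have : c • y * x = y * (c * x : 𝓞 K) := by
      rw [Algebra.smul_def, coe_mul_ringOfIntegers]; ring
    rw [this]
    exact hy (c * x)

theorem mem_dualLattice {y : K} : y ∈ dualLattice l ↔ ∀ x : 𝓞 K, l (y * x) ∈ ratInt := Iff.rfl

theorem coe_mem_dualLattice (hl : ∀ x : 𝓞 K, l x ∈ ratInt) (x : 𝓞 K) : (x : K) ∈ dualLattice l :=
  fun y => by rw [← coe_mul_ringOfIntegers]; exact hl _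

section Orthogonal

variable {ι : Type*} [Fintype ι] (v : Basis ι ℚ K) {t : K}

theorem repr_eq_of_orthogonal (hv : ∀ i j, i ≠ j → l (t * (v i * v j)) = 0) (x : K) (i : ι) :
    l (t * (x * v i)) = v.repr x i * l (t * (v i * v i)) := by
  classical
  conv_lhs => rw [← v.sum_repr x, Finset.sum_mul, Finset.mul_sum, map_sum]
  rw [Finset.sum_eq_single i]
  · simp
  · intro j _ hj
    simp [hv j i hj]
  · simp

theorem map_mul_sq_of_orthogonal (hv : ∀ i j, i ≠ j → l (t * (v i * v j)) = 0) (x : K) :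
    l (t * (x * x)) = ∑ i, v.repr x i ^ 2 * l (t * (v i * v i)) := by
  conv_lhs => enter [2, 2, 2]; rw [← v.sum_repr x]
  rw [Finset.mul_sum, Finset.mul_sum, map_sum]
  refine Finset.sum_congr rfl fun i _ => ?_
  rw [mul_smul_comm, mul_smul_comm, map_smul, repr_eq_of_orthogonal v hv, smul_eq_mul]
  ring

/-- The lattice dual to the span of `v` with respect to `(x, y) ↦ l (2 * t * (x * y))`. -/
def halfDual (l : K →ₗ[ℚ] ℚ) (v : Basis ι ℚ K) (t : K) : AddSubgroup K where
  carrier := {x | ∀ i, 2 * l (t * (x * v i)) ∈ ratInt}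
  zero_mem' i := by simp [ratInt.zero_mem]
  add_mem' hx hy i := by
    rw [add_mul, mul_add, map_add, mul_add]; exact ratInt.add_mem (hx i) (hy i)
  neg_mem' hx i := by
    rw [neg_mul, mul_neg, map_neg, mul_neg]; exact ratInt.neg_mem (hx i)

theorem halfDual_fg (hv : ∀ i j, i ≠ j → l (t * (v i * v j)) = 0)
    (hv' : ∀ i, l (t * (v i * v i)) ≠ 0) : AddGroup.FG (halfDual l v t) := by
  refine AddSubgroup.fg_of_le_span (w := fun i => (2 * l (t * (v i * v i)))⁻¹ • v i) fun x hx => ?_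
  rw [← v.sum_repr x]
  refine Submodule.sum_mem _ fun i _ => ?_
  obtain ⟨n, hn⟩ := mem_ratInt.1 (hx i)
  rw [repr_eq_of_orthogonal v hv] at hn
  have : v.repr x i • v i = n • (2 * l (t * (v i * v i)))⁻¹ • v i := by
    rw [← Int.cast_smul_eq_zsmul ℚ, ← hn, smul_smul]
    congr 1
    field_simp [hv' i]
    rw [mul_div_cancel_right₀ _ (by simpa [sq] using hv' i)]
  rw [this]
  exact Submodule.smul_mem _ _ (Submodule.subset_span ⟨i, rfl⟩)

end Orthogonal

theorem dualLattice_fg (hl0 : l ≠ 0) : AddGroup.FG (dualLattice l) := by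
  obtain ⟨v, hint, hv, hv'⟩ := exists_integral_orthogonal_basis hl0 (one_ne_zero (α := K))
  obtain ⟨e, he⟩ := exists_coe_eq_of_isIntegral hint
  refine AddSubgroup.fg_of_le_span (C := (dualLattice l).toAddSubgroup)
    (w := fun i => (l (1 * (v i * v i)))⁻¹ • v i) fun x hx => ?_
  rw [← v.sum_repr x]
  refine Submodule.sum_mem _ fun i _ => ?_
  obtain ⟨n, hn⟩ := mem_ratInt.1 (hx (e i))
  have hn' := repr_eq_of_orthogonal v hv x i
  rw [one_mul, he i] at hn'
  have : v.repr x i • v i = n • (l (1 * (v i * v i)))⁻¹ • v i := by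
    rw [← Int.cast_smul_eq_zsmul ℚ, ← hn, smul_smul, hn', ← he i, mul_assoc,
      mul_inv_cancel₀ (hv' i), mul_one]
  rw [this]
  exact Submodule.smul_mem _ _ (Submodule.subset_span ⟨i, rfl⟩)

/-- **Milgram's formula**, up to a positive factor. -/
theorem hasMean_milgram (hl : ∀ x : 𝓞 K, l x ∈ ratInt) {t : 𝓞 K} (ht : t ≠ 0)
    {ι : Type*} [Fintype ι] (v : Basis ι ℚ K)
    (hint : ∀ i, IsIntegral ℤ (v i))
    (hv : ∀ i j, i ≠ j → l (t * (v i * v j)) = 0) (hv' : ∀ i, l (t * (v i * v i)) ≠ 0)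
    {h : ℂ} (hh : HasMean (fun x : dualLattice l => expQ (l ((4 * t : K)⁻¹ * (x * x)))) h) :
    ∃ r : ℝ, 0 < r ∧ h = r * expQ ((∑ i, (SignType.sign (l (t * (v i * v i))) : ℚ)) / 8) := by
  classical
  have ht' : (t : K) ≠ 0 := by simpa using ht
  obtain ⟨e, he⟩ := exists_coe_eq_of_isIntegral hint
  have l2 (x : K) : l (2 * x) = 2 * l x := by rw [two_mul, map_add, two_mul]
  choose d hd using fun i => mem_ratInt.1 (hl (t * (e i * e i)))
  replace hd (i) : l (t * (v i * v i)) = d i := by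
    rw [← hd, he, coe_mul_ringOfIntegers, coe_mul_ringOfIntegers]
  have hd0 (i) : d i ≠ 0 := fun h0 => hv' i (by rw [hd, h0, Int.cast_zero])
  have hFG := halfDual_fg v hv hv'
  let φ : halfDual l v t →+ (ι → ℤ) := AddMonoidHom.mk' (fun x i => ⌊2 * l (t * (x * v i))⌋) (by
    intro x y
    ext i
    obtain ⟨n, hn⟩ := mem_ratInt.1 (x.2 i)
    obtain ⟨m, hm⟩ := mem_ratInt.1 (y.2 i)
    simp only [AddSubgroup.coe_add, add_mul, mul_add, map_add, Pi.add_apply]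
    rw [hn, hm]; simp)
  have hφ (x : halfDual l v t) (i) : (φ x i : ℚ) = 2 * v.repr x i * d i := by
    obtain ⟨n, hn⟩ := mem_ratInt.1 (x.2 i)
    rw [mul_assoc, ← hd, ← repr_eq_of_orthogonal v hv]
    change ((⌊2 * l (t * (x * v i))⌋ : ℤ) : ℚ) = _
    rw [hn, Int.floor_intCast]
  have hφs : Function.Surjective φ := by
    intro k
    have hx (i) : 2 * l (t * ((∑ j, (k j / (2 * d j) : ℚ) • v j) * v i)) = k i := by
      rw [repr_eq_of_orthogonal v hv, v.repr_sum_self, hd]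
      have : (d i : ℚ) ≠ 0 := by exact_mod_cast hd0 i
      field_simp
    refine ⟨⟨∑ j, (k j / (2 * d j) : ℚ) • v j, fun i => by rw [hx]; simp⟩, ?_⟩
    ext i
    change ⌊2 * l (t * ((∑ j, (k j / (2 * d j) : ℚ) • v j) * v i))⌋ = _
    rw [hx, Int.floor_intCast]
  have h1 := (HasMean.pi fun i => hasMean_gauss (hd0 i)).comp_of_surjective φ hφs
  have h2 : HasMean (fun x : halfDual l v t => expQ (l (t * (x * x : K))))
      (∏ i, (((√(2 * |(d i : ℝ)|))⁻¹ : ℝ) * expQ (SignType.sign (d i) / 8))) := by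
    refine h1.congr fun x => ?_
    rw [← expQ_sum, map_mul_sq_of_orthogonal v hv]
    congr 1
    refine Finset.sum_congr rfl fun i _ => ?_
    rw [hφ, hd]
    have : (d i : ℚ) ≠ 0 := by exact_mod_cast hd0 i
    field_simp
    ring
  clear h1
  let N : ℕ := (∏ i, d i).natAbs
  have hN : 0 < N := Int.natAbs_pos.2 (Finset.prod_ne_zero_iff.2 fun i _ => hd0 i)
  have key (x : K) (hx : x ∈ halfDual l v t) (y : 𝓞 K) : N * (2 * l (t * (x * y))) ∈ ratInt := by
    have h3 : (∏ i, d i : ℤ) * (2 * l (t * (x * y))) ∈ ratInt := by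
      rw [← v.sum_repr (y : K), Finset.mul_sum, Finset.mul_sum, map_sum, Finset.mul_sum, Finset.mul_sum]
      refine ratInt.sum_mem fun i _ => ?_
      rw [← Finset.mul_prod_erase _ _ (Finset.mem_univ i)]
      have h4 := repr_eq_of_orthogonal v hv y i
      have h5 : l (t * (y * v i)) ∈ ratInt := by
        rw [he, ← coe_mul_ringOfIntegers, ← coe_mul_ringOfIntegers]
        exact hl _
      have h6 := mul_mem_ratInt (intCast_mem_ratInt (∏ j ∈ Finset.univ.erase i, d j))
        (mul_mem_ratInt h5 (hx i))
      rw [h4, hd] at h6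
      convert h6 using 1
      rw [mul_smul_comm, mul_smul_comm, map_smul, smul_eq_mul]
      push_cast
      ring
    rcases Int.natAbs_eq (∏ i, d i) with h4 | h4
    · rw [h4, Int.cast_natCast] at h3; exact h3
    · rw [h4, Int.cast_neg, Int.cast_natCast, neg_mul] at h3
      exact neg_mem_iff.1 h3
  let C : AddSubgroup (halfDual l v t) :=
    ((dualLattice l).toAddSubgroup.comap (AddMonoidHom.mulLeft (2 * t : K))).comap
      (halfDual l v t).subtype
  have hC (x : halfDual l v t) : x ∈ C ↔ ∀ y : 𝓞 K, 2 * l (t * (x * y)) ∈ ratInt := by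
    change (∀ y : 𝓞 K, l (2 * t * x * y) ∈ ratInt) ↔ _
    refine forall_congr' fun y => ?_
    rw [mul_assoc, mul_assoc, l2]
  have hCfin : Finite (halfDual l v t ⧸ C) := by
    refine finite_quotient_of_nsmul_mem hN fun x => (hC _).2 fun y => ?_
    convert key x x.2 y using 1
    rw [AddSubgroup.coe_nsmul, smul_mul_assoc, mul_smul_comm, map_nsmul, nsmul_eq_mul]
    ring
  have : AddGroup.FG (𝓞 K) := Module.Finite.iff_addGroup_fg.1 inferInstance
  obtain ⟨n, s, hn, hs⟩ := exists_averaging_family (𝓞 K) hN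
  have := Fin.pos_iff_nonempty.1 hn
  have hO (z : 𝓞 K) : (z : K) ∈ halfDual l v t := fun i => by
    rw [he, ← coe_mul_ringOfIntegers, ← coe_mul_ringOfIntegers]
    exact mul_mem_ratInt (intCast_mem_ratInt 2) (hl _)
  have h3 : HasMean (fun x : halfDual l v t => if x ∈ C then expQ (l (t * (x * x : K))) else 0)
      (∏ i, (((√(2 * |(d i : ℝ)|))⁻¹ : ℝ) * expQ (SignType.sign (d i) / 8))) := by
    refine h2.translates (fun i => ⟨s i, hO _⟩) fun x => ?_
    have h4 (z : 𝓞 K) : expQ (l (t * ((x + z) * (x + z)))) =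
        expQ (l (t * (x * x : K))) * expQ (2 * l (t * (x * z))) := by
      rw [← expQ_add]
      refine expQ_congr ?_
      have h5 := hl (t * (z * z))
      rw [coe_mul_ringOfIntegers, coe_mul_ringOfIntegers] at h5
      convert h5 using 1
      rw [← l2, ← map_add, ← map_sub]
      ring_nf
    have h5 (y z : 𝓞 K) : expQ (2 * l (t * (x * (y + z : 𝓞 K)))) =
        expQ (2 * l (t * (x * y))) * expQ (2 * l (t * (x * z))) := by
      rw [← expQ_add, coe_add_ringOfIntegers, mul_add, mul_add, map_add, mul_add]
    obtain ⟨m, hm⟩ := hs (fun z => expQ (2 * l (t * (x * z)))) fun y z => by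
      have h6 : ((N • z : 𝓞 K) : K) = N • (z : K) := map_nsmul _ _ _
      have h7 : expQ (2 * l (t * (x * (N • z : 𝓞 K)))) = 1 := by
        refine expQ_eq_one_iff.2 ?_
        convert key x x.2 z using 1
        rw [h6, mul_smul_comm, mul_smul_comm, map_nsmul, nsmul_eq_mul]
        ring
      rw [h5, h7, mul_one]
    have hmean : HasMean (fun z : 𝓞 K => expQ (2 * l (t * (x * z)))) m := ⟨n, s, hn, hm⟩
    simp only [AddSubgroup.coe_add, h4, ← Finset.mul_sum]
    have hm0 := hm 0
    simp only [zero_add] at hm0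
    rw [hm0, Fintype.card_fin]
    split_ifs with hx
    · have : m = 1 := hmean.unique ((HasMean.const 1).congr fun z =>
        (expQ_eq_one_iff.2 ((hC x).1 hx z)).symm)
      rw [this]; ring
    · rw [hC] at hx
      push Not at hx
      obtain ⟨z, hz⟩ := hx
      rw [hmean.addChar_eq_zero h5 (a := z) (mt expQ_eq_one_iff.1 hz)]
      ring
  have h4 : HasMean (fun x : C => expQ (l (t * (x * x : K)))) h := by
    let g : C →+ dualLattice l := AddMonoidHom.mk' (fun x => ⟨2 * t * x, x.2⟩) (by
      intro x y
      ext
      exact mul_add _ _ _)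
    refine (hh.comp_of_surjective g fun y => ?_).congr fun x => ?_
    · have hy (z : 𝓞 K) : 2 * l (t * ((2 * t : K)⁻¹ * y * z)) ∈ ratInt := by
        rw [← l2]
        convert mem_dualLattice.1 y.2 z using 2
        field_simp
      refine ⟨⟨⟨(2 * t : K)⁻¹ * y, fun i => ?_⟩, ?_⟩, ?_⟩
      · rw [he]; exact hy _
      · rw [hC]; exact hy
      · ext
        exact mul_inv_cancel_left₀ (by simpa using ht) _
    · change expQ (l ((4 * t : K)⁻¹ * (2 * t * x * (2 * t * x)))) = _
      congr 2
      field_simp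
      ring
  have h5 := h3.unique (h4.extend_by_zero C (f := fun x : halfDual l v t => expQ (l (t * (x * x : K)))))
  have hcard : 0 < Nat.card (halfDual l v t ⧸ C) := Nat.card_pos
  have hcard' : (Nat.card (halfDual l v t ⧸ C) : ℂ) ≠ 0 := by exact_mod_cast hcard.ne'
  rw [eq_div_iff hcard', Finset.prod_mul_distrib, ← expQ_sum] at h5
  refine ⟨(∏ i, (√(2 * |(d i : ℝ)|))⁻¹) * Nat.card (halfDual l v t ⧸ C), ?_, ?_⟩
  · refine mul_pos (Finset.prod_pos fun i _ => ?_) (by exact_mod_cast hcard)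
    have := hd0 i
    positivity
  · rw [← h5, Finset.sum_div]
    simp only [hd]
    push_cast
    have hsign (i : ι) : SignType.sign (d i : ℚ) = SignType.sign (d i) := by
      rcases lt_trichotomy (d i) 0 with h | h | h
      · rw [sign_neg h, sign_neg (by exact_mod_cast h)]
      · rw [h, Int.cast_zero, sign_zero, sign_zero]
      · rw [sign_pos h, sign_pos (by exact_mod_cast h)]
    simp only [hsign]
    ring

theorem sum_sign_eq {ι : Type*} [Fintype ι] {d : ι → ℚ} (hd : ∀ i, d i ≠ 0) :
    ∑ i, (SignType.sign (d i) : ℚ) = 2 * ({i | 0 < d i}.ncard : ℚ) - Fintype.card ι := by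
  classical
  have key (i : ι) : (SignType.sign (d i) : ℚ) = 2 * (if 0 < d i then 1 else 0) - 1 := by
    rcases (hd i).lt_or_gt with h | h
    · rw [sign_neg h, if_neg h.not_gt]; norm_num
    · rw [sign_pos h, if_pos h]; norm_num
  simp only [key, Finset.sum_sub_distrib, ← Finset.mul_sum, Finset.sum_boole]
  rw [Set.ncard_eq_toFinset_card']
  simp

/-- The Gauss sums attached to `t` and `t * a` differ by a positive factor if `a` is totally
positive. -/
theorem hasMean_mul_totally_positive (hl : ∀ x : 𝓞 K, l x ∈ ratInt) (hl0 : l ≠ 0) {t a : 𝓞 K}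
    (ht : t ≠ 0) (ha0 : a ≠ 0) (ha : ∀ σ : K →+* ℝ, 0 < σ a) {h h' : ℂ}
    (hh : HasMean (fun x : dualLattice l => expQ (l ((4 * t : K)⁻¹ * (x * x)))) h)
    (hh' : HasMean (fun x : dualLattice l => expQ (l ((4 * (t * a) : K)⁻¹ * (x * x)))) h') :
    h ≠ 0 ∧ ∃ r : ℝ, 0 < r ∧ h' = r * h := by
  have ht' : (t : K) ≠ 0 := by simpa using ht
  have ha' : (a : K) ≠ 0 := by simpa using ha0
  obtain ⟨v, vint, hv, hv'⟩ := exists_integral_orthogonal_basis hl0 ht'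
  obtain ⟨w, wint, hw, hw'⟩ := exists_integral_orthogonal_basis hl0 (mul_ne_zero ht' ha')
  obtain ⟨r, hr, rfl⟩ := hasMean_milgram hl ht v vint hv hv' hh
  rw [← coe_mul_ringOfIntegers] at hh' hw hw'
  obtain ⟨r', hr', rfl⟩ := hasMean_milgram hl (mul_ne_zero ht ha0) w wint hw hw' hh'
  rw [coe_mul_ringOfIntegers] at hw hw'
  have hr0 : (r : ℂ) ≠ 0 := by exact_mod_cast hr.ne'
  refine ⟨mul_ne_zero hr0 (Complex.exp_ne_zero _), r' / r, by positivity, ?_⟩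
  rw [coe_mul_ringOfIntegers, sum_sign_eq hv', sum_sign_eq hw',
    ncard_pos_eq_of_totally_positive ha ha' v hv hv' w hw hw']
  push_cast
  field_simp

end Milgram

section LocalSolvability

open Polynomial in
theorem exists_quadratic_root_of_isNilpotent {R : Type*} [CommRing R] {p d q : R} (hp : IsNilpotent p)
    (hd : IsUnit d) : ∃ t, p + d * t + q * t ^ 2 = 0 := by
  obtain ⟨t, ⟨-, ht⟩, -⟩ := existsUnique_nilpotent_sub_and_aeval_eq_zero
    (P := C p + C d * X + C q * X ^ 2) (x := (0 : R)) (by simpa using hp) (by simpa using hd)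
  exact ⟨t, by simpa using ht⟩

open Polynomial in
theorem FiniteField.exists_quadratic_form_eq_one {F : Type*} [Field F] [Finite F] (h2 : (2 : F) ≠ 0)
    {a b : F} (ha : a ≠ 0) (hb : b ≠ 0) : ∃ x y, a * x ^ 2 + b * y ^ 2 = 1 := by
  have : Fintype F := Fintype.ofFinite F
  have hF : ringChar F ≠ 2 := fun h => h2 (by
    have := ringChar.Nat.cast_ringChar (R := F)
    rw [h] at this
    exact_mod_cast this)
  obtain ⟨x, y, h⟩ := FiniteField.exists_root_sum_quadratic (R := F)
    (f := C a * X ^ 2 + C 0 * X + C (-1)) (g := C b * X ^ 2 + C 0 * X + C 0)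
    (degree_quadratic ha) (degree_quadratic hb) (FiniteField.odd_card_of_char_ne_two hF)
  refine ⟨x, y, ?_⟩
  simp only [eval_add, eval_mul, eval_C, eval_pow, eval_X] at h
  linear_combination h

/-- Over a finite field, a conic with a smooth point whose tangent direction is recorded. -/
theorem FiniteField.exists_smooth_point {F : Type*} [Field F] [Finite F] {a b r : F} (ha : a ≠ 0)
    (hb : b ≠ 0) (har : a = 1 + 8 * r) : ∃ w z α β : F,
      2 * r + a * (w ^ 2 + w) + b * z ^ 2 = 0 ∧ a * (2 * w + 1) * α + 2 * b * z * β = 1 := by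
  by_cases h2 : (2 : F) = 0
  · refine ⟨0, 0, 1, 0, ?_, ?_⟩
    · linear_combination r * h2
    · linear_combination har + 4 * r * h2
  obtain ⟨x, y, h⟩ := FiniteField.exists_quadratic_form_eq_one h2 ha hb
  refine ⟨(x - 1) / 2, y / 2, x, y, ?_, ?_⟩
  · field_simp
    linear_combination h - har
  · field_simp
    linear_combination h

theorem IsField.exists_smooth_point {F : Type*} [CommRing F] [Finite F] (hF : IsField F) {a b r : F}
    (ha : a ≠ 0) (hb : b ≠ 0) (har : a = 1 + 8 * r) : ∃ w z α β : F,
      2 * r + a * (w ^ 2 + w) + b * z ^ 2 = 0 ∧ a * (2 * w + 1) * α + 2 * b * z * β = 1 :=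
  let _ := hF.toField
  FiniteField.exists_smooth_point ha hb har

theorem exists_quadratic_form_eq_one {S : Type*} [CommRing S] [Finite S] {a b r : S}
    (ha : IsUnit a) (hb : IsUnit b) (har : a = 1 + 8 * r) : ∃ x y, a * x ^ 2 + b * y ^ 2 = 1 := by
  have key (m : MaximalSpectrum S) : ∃ w z α β : S,
      2 * r + a * (w ^ 2 + w) + b * z ^ 2 ∈ m.asIdeal ∧
        a * (2 * w + 1) * α + 2 * b * z * β - 1 ∈ m.asIdeal := by
    have hm := m.isMaximal
    have hF : IsField (S ⧸ m.asIdeal) :=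
      (Ideal.Quotient.maximal_ideal_iff_isField_quotient _).1 hm
    have : Nontrivial (S ⧸ m.asIdeal) := hF.nontrivial
    have : Finite (S ⧸ m.asIdeal) := Quotient.finite _
    let π := Ideal.Quotient.mk m.asIdeal
    obtain ⟨w, z, α, β, h, h'⟩ := hF.exists_smooth_point (a := π a) (b := π b) (r := π r)
      (ha.map π).ne_zero (hb.map π).ne_zero (by rw [har, map_add, map_mul, map_one, map_ofNat])
    obtain ⟨w, rfl⟩ := Ideal.Quotient.mk_surjective w
    obtain ⟨z, rfl⟩ := Ideal.Quotient.mk_surjective z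
    obtain ⟨α, rfl⟩ := Ideal.Quotient.mk_surjective α
    obtain ⟨β, rfl⟩ := Ideal.Quotient.mk_surjective β
    refine ⟨w, z, α, β, ?_, ?_⟩
    · rw [← Ideal.Quotient.eq_zero_iff_mem, ← h]; simp [π, map_ofNat (Ideal.Quotient.mk m.asIdeal)]
    · rw [← Ideal.Quotient.eq_zero_iff_mem, ← sub_eq_zero.2 h']
      simp [π, map_ofNat (Ideal.Quotient.mk m.asIdeal)]
  choose w' z' α' β' hG hT using key
  have hco : Pairwise (Function.onFun IsCoprime fun m : MaximalSpectrum S => m.asIdeal) := by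
    intro m n hmn
    have := m.isMaximal
    have := n.isMaximal
    exact Ideal.isCoprime_of_isMaximal fun h => hmn (MaximalSpectrum.ext h)
  obtain ⟨w, hw⟩ := Ideal.exists_forall_sub_mem_ideal hco w'
  obtain ⟨z, hz⟩ := Ideal.exists_forall_sub_mem_ideal hco z'
  obtain ⟨α, hα⟩ := Ideal.exists_forall_sub_mem_ideal hco α'
  obtain ⟨β, hβ⟩ := Ideal.exists_forall_sub_mem_ideal hco β'
  simp only [← Ideal.Quotient.mk_eq_mk_iff_sub_mem] at hw hz hα hβ
  have nil (s : S) (hs : ∀ m : MaximalSpectrum S, s ∈ m.asIdeal) : IsNilpotent s := by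
    rw [← mem_nilradical, IsArtinianRing.nilradical_eq_iInf, Ideal.mem_iInf]
    exact hs
  have h1 : IsNilpotent (2 * r + a * (w ^ 2 + w) + b * z ^ 2) := nil _ fun m => by
    rw [← Ideal.Quotient.eq_zero_iff_mem, ← Ideal.Quotient.eq_zero_iff_mem.2 (hG m)]
    simp [map_ofNat (Ideal.Quotient.mk m.asIdeal), hw m, hz m]
  have h2 : IsNilpotent (a * (2 * w + 1) * α + 2 * b * z * β - 1) := nil _ fun m => by
    rw [← Ideal.Quotient.eq_zero_iff_mem, ← Ideal.Quotient.eq_zero_iff_mem.2 (hT m)]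
    simp [map_ofNat (Ideal.Quotient.mk m.asIdeal), hw m, hz m, hα m, hβ m]
  have h3 : IsUnit (a * (2 * w + 1) * α + 2 * b * z * β) := by
    simpa using h2.isUnit_add_one
  obtain ⟨t, ht⟩ := exists_quadratic_root_of_isNilpotent (q := a * α ^ 2 + b * β ^ 2) h1 h3
  refine ⟨1 + 2 * (w + α * t), 2 * (z + β * t), ?_⟩
  linear_combination 4 * ht + har

theorem exists_quadratic_form_sub_one_mem {R : Type*} [CommRing R] {I : Ideal R} [Finite (R ⧸ I)]
    {a b : R} (ha : IsUnit (Ideal.Quotient.mk I a)) (hb : IsUnit (Ideal.Quotient.mk I b))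
    (ha8 : (8 : R) ∣ a - 1) : ∃ x y, a * x ^ 2 + b * y ^ 2 - 1 ∈ I := by
  obtain ⟨r, hr⟩ := ha8
  obtain ⟨x, y, h⟩ := exists_quadratic_form_eq_one ha hb (r := Ideal.Quotient.mk I r) (by
    rw [eq_add_of_sub_eq hr, add_comm, map_add, map_mul, map_one, map_ofNat])
  obtain ⟨x, rfl⟩ := Ideal.Quotient.mk_surjective x
  obtain ⟨y, rfl⟩ := Ideal.Quotient.mk_surjective y
  refine ⟨x, y, ?_⟩
  rw [← Ideal.Quotient.eq_zero_iff_mem, ← sub_eq_zero.2 h]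
  simp

end LocalSolvability

section FiniteFieldGaussSum

open Classical in
/-- The sign `1` or `-1` according to whether `P` holds. -/
noncomputable def propSign (P : Prop) : ℝ := if P then 1 else -1

theorem iff_of_propSign_mul_pos {P Q : Prop} (h : 0 < propSign P * propSign Q) : P ↔ Q := by
  unfold propSign at h
  split_ifs at h with hP hQ hQ <;> first | tauto | norm_num at h

theorem propSign_congr {P Q : Prop} (h : P ↔ Q) : propSign P = propSign Q := by rw [propext h]

theorem FiniteField.sum_mul_sq {F : Type*} [Field F] [Fintype F] (h2 : (2 : F) ≠ 0) {φ : F → ℂ}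
    (h0 : ∑ x, φ x = 0) {b : F} (hb : b ≠ 0) :
    ∑ x, φ (b * x ^ 2) = propSign (IsSquare b) * ∑ x, φ (x ^ 2) := by
  classical
  have hF : ringChar F ≠ 2 := fun h => h2 (by
    have := ringChar.Nat.cast_ringChar (R := F)
    rw [h] at this
    exact_mod_cast this)
  have hχ : (quadraticChar F b : ℂ) = propSign (IsSquare b) := by
    unfold propSign
    split_ifs with h
    · rw [(quadraticChar_one_iff_isSquare hb).2 h]; simp
    · rw [quadraticChar_neg_one_iff_not_isSquare.2 h]; simp
  have h3 : (quadraticChar F b : ℂ) * quadraticChar F b = 1 := by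
    exact_mod_cast (sq _).symm.trans (quadraticChar_sq_one hb)
  have key (c : F) (hc : c ≠ 0) :
      ∑ x, φ (c * x ^ 2) = ∑ y, φ (c * y) * quadraticChar F y := by
    have h1 : ∑ y, φ (c * y) = 0 := by
      rw [← h0]; exact Equiv.sum_comp (Equiv.mulLeft₀ c hc) φ
    rw [← Finset.sum_fiberwise Finset.univ (fun x : F => x ^ 2)]
    rw [← add_zero (∑ y, φ (c * y) * (quadraticChar F y : ℂ)), ← h1, ← Finset.sum_add_distrib]
    refine Finset.sum_congr rfl fun y _ => ?_
    have h4 := quadraticChar_card_sqrts hF y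
    rw [Finset.sum_congr rfl (g := fun _ => φ (c * y)) fun x hx => by
      rw [(Finset.mem_filter.1 hx).2], Finset.sum_const, nsmul_eq_mul]
    have h5 : ((Finset.univ.filter fun x : F => x ^ 2 = y).card : ℂ) = quadraticChar F y + 1 := by
      rw [Set.toFinset_ofPred] at h4
      exact_mod_cast h4
    rw [h5]; ring
  have h6 := key 1 one_ne_zero
  simp only [one_mul] at h6
  rw [key b hb, h6, ← hχ, ← Equiv.sum_comp (Equiv.mulLeft₀ b hb) (fun y => φ y * (quadraticChar F y : ℂ)), Finset.mul_sum]
  refine Finset.sum_congr rfl fun y _ => ?_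
  change φ (b * y) * (quadraticChar F y : ℂ) = _ * (φ (b * y) * (quadraticChar F (b * y) : ℂ))
  rw [map_mul]
  push_cast
  linear_combination (-φ (b * y) * quadraticChar F y) * h3

theorem isSquare_mk_iff {R : Type*} [CommRing R] {I : Ideal R} {b : R} :
    IsSquare (Ideal.Quotient.mk I b) ↔ ∃ u, b - u ^ 2 ∈ I := by
  constructor
  · rintro ⟨y, hy⟩
    obtain ⟨u, rfl⟩ := Ideal.Quotient.mk_surjective y
    exact ⟨u, by rw [← Ideal.Quotient.mk_eq_mk_iff_sub_mem, map_pow, sq]; exact hy⟩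
  · rintro ⟨u, hu⟩
    refine ⟨Ideal.Quotient.mk I u, ?_⟩
    rwa [← Ideal.Quotient.mk_eq_mk_iff_sub_mem, map_pow, sq] at hu

theorem HasMean.comp_of_surjective_fintype {A B : Type*} [AddCommGroup A] [AddCommGroup B]
    [Fintype B] (π : A →+ B) (hπ : Function.Surjective π) (f : B → ℂ) :
    HasMean (fun x => f (π x)) ((∑ y, f y) / Fintype.card B) := by
  refine HasMean.of_fintype (Function.surjInv hπ) fun x => ?_
  have : (Fintype.card B : ℂ) ≠ 0 := by exact_mod_cast Fintype.card_ne_zero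
  rw [mul_div_cancel₀ _ this]
  simp only [map_add, Function.surjInv_eq]
  exact Equiv.sum_comp (Equiv.addLeft (π x)) f

/-- The dependence of a quadratic Gauss sum modulo a maximal ideal on its numerator. -/
theorem HasMean.mul_sq_of_isMaximal {R : Type*} [CommRing R] {I : Ideal R} (hI : I.IsMaximal)
    [Finite (R ⧸ I)] (h2 : (2 : R) ∉ I) {f : R → ℂ} (hf : ∀ x y, f (x + y) = f x * f y)
    (hfI : ∀ x ∈ I, f x = 1) (hf1 : ∃ x, f x ≠ 1) {b : R} (hb : b ∉ I) {m m' : ℂ}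
    (h : HasMean (fun x => f (x ^ 2)) m) (h' : HasMean (fun x => f (b * x ^ 2)) m') :
    m' = propSign (∃ u, b - u ^ 2 ∈ I) * m := by
  let _ := Ideal.Quotient.field I
  have : Fintype (R ⧸ I) := Fintype.ofFinite _
  let π := Ideal.Quotient.mk I
  have hπ : Function.Surjective π := Ideal.Quotient.mk_surjective
  let φ : R ⧸ I → ℂ := fun q => f (Function.surjInv hπ q)
  have hφ (x : R) : φ (π x) = f x := by
    have h1 : x - Function.surjInv hπ (π x) ∈ I := by
      rw [← Ideal.Quotient.mk_eq_mk_iff_sub_mem]; exact (Function.surjInv_eq hπ _).symm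
    rw [← sub_add_cancel x (Function.surjInv hπ (π x)), hf, hfI _ h1, one_mul, sub_add_cancel]
  have hm := h.unique ((HasMean.comp_of_surjective_fintype π.toAddMonoidHom hπ
    fun y => φ (y ^ 2)).congr fun x => (by rw [← hφ]; simp [π]))
  have hm' := h'.unique ((HasMean.comp_of_surjective_fintype π.toAddMonoidHom hπ
    fun y => φ (π b * y ^ 2)).congr fun x => (by rw [← hφ]; simp [π]))
  have h0 : ∑ y, φ y = 0 := by
    have h1 := HasMean.comp_of_surjective_fintype π.toAddMonoidHom hπ φ
    obtain ⟨x, hx⟩ := hf1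
    have h3 := (h1.congr hφ).addChar_eq_zero hf hx
    rwa [div_eq_zero_iff, or_iff_left (by exact_mod_cast Fintype.card_ne_zero)] at h3
  have h3 : (2 : R ⧸ I) ≠ 0 := fun h => h2 (by
    rw [← Ideal.Quotient.eq_zero_iff_mem, map_ofNat]; exact h)
  rw [hm, hm', FiniteField.sum_mul_sq h3 h0 (by rwa [Ne, Ideal.Quotient.eq_zero_iff_mem]),
    propSign_congr (isSquare_mk_iff (I := I))]
  ring

end FiniteFieldGaussSum

section Lattice

variable {K : Type*} [Field K] [NumberField K] {l : K →ₗ[ℚ] ℚ}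

theorem exists_map_inv_not_mem_ratInt {a : 𝓞 K} (ha : ¬ IsUnit a) (ha0 : a ≠ 0) :
    ∃ l : K →ₗ[ℚ] ℚ, (∀ x : 𝓞 K, l x ∈ ratInt) ∧ l (a : K)⁻¹ ∉ ratInt := by
  have hrange (q : ℚ) : q ∈ Set.range (algebraMap ℤ ℚ) ↔ q ∈ ratInt := by
    rw [mem_ratInt]
    exact exists_congr fun n => eq_comm
  have key (x : K) : (∀ i, (integralBasis K).repr x i ∈ ratInt) ↔ ∃ y : 𝓞 K, (y : K) = x := by
    simp only [← hrange]
    rw [← Module.Basis.mem_span_iff_repr_mem ℤ, mem_span_integralBasis]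
    rfl
  have h1 : ¬ ∃ y : 𝓞 K, (y : K) = (a : K)⁻¹ := by
    rintro ⟨y, hy⟩
    refine ha (IsUnit.of_mul_eq_one y (RingOfIntegers.ext ?_))
    rw [coe_mul_ringOfIntegers, hy, mul_inv_cancel₀ (by simpa using ha0)]
    simp
  rw [← key] at h1
  push Not at h1
  obtain ⟨i, hi⟩ := h1
  exact ⟨(integralBasis K).coord i, fun x => (key x).2 ⟨x, rfl⟩ i, hi⟩

theorem exists_map_inv_not_mem_ratInt₂ {a b : 𝓞 K} (ha : ¬ IsUnit a) (ha0 : a ≠ 0)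
    (hb : ¬ IsUnit b) (hb0 : b ≠ 0) : ∃ l : K →ₗ[ℚ] ℚ,
      (∀ x : 𝓞 K, l x ∈ ratInt) ∧ l (a : K)⁻¹ ∉ ratInt ∧ l (b : K)⁻¹ ∉ ratInt := by
  obtain ⟨f, hf, hfa⟩ := exists_map_inv_not_mem_ratInt ha ha0
  obtain ⟨g, hg, hgb⟩ := exists_map_inv_not_mem_ratInt hb hb0
  by_cases hfb : f (b : K)⁻¹ ∈ ratInt
  · by_cases hga : g (a : K)⁻¹ ∈ ratInt
    · refine ⟨f + g, fun x => ratInt.add_mem (hf x) (hg x), ?_, ?_⟩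
      · rw [LinearMap.add_apply]
        exact fun h => hfa ((ratInt.add_mem_cancel_right hga).1 h)
      · rw [LinearMap.add_apply]
        exact fun h => hgb ((ratInt.add_mem_cancel_left hfb).1 h)
    · exact ⟨g, hg, hga, hgb⟩
  · exact ⟨f, hf, hfa, hfb⟩

theorem exists_nsmul_eq_coe (y : K) : ∃ n : ℕ, 0 < n ∧ ∃ o : 𝓞 K, n • y = o := by
  obtain ⟨⟨o, s⟩, h⟩ := IsLocalization.surj (Algebra.algebraMapSubmonoid (𝓞 K) (nonZeroDivisors ℤ)) y
  obtain ⟨_, n, hn, rfl⟩ := s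
  have hn0 : n ≠ 0 := nonZeroDivisors.ne_zero hn
  have h1 : y * n = o := by simpa using h
  refine ⟨n.natAbs, Int.natAbs_pos.2 hn0, ?_⟩
  rcases Int.natAbs_eq n with h2 | h2
  · refine ⟨o, ?_⟩
    rw [← h1, nsmul_eq_mul, mul_comm]
    conv_rhs => rw [h2, Int.cast_natCast]
  · refine ⟨-o, ?_⟩
    have h3 : ((-o : 𝓞 K) : K) = -o := map_neg _ _
    rw [h3, ← h1, nsmul_eq_mul, mul_comm]
    conv_rhs => rw [h2, Int.cast_neg, Int.cast_natCast, mul_neg, neg_neg]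

theorem exists_nsmul_dualLattice (hl0 : l ≠ 0) :
    ∃ n : ℕ, 0 < n ∧ ∀ y ∈ dualLattice l, ∃ o : 𝓞 K, n • y = o := by
  have := dualLattice_fg hl0
  let C : AddSubgroup (dualLattice l) :=
    (algebraMap (𝓞 K) K).toAddMonoidHom.range.comap (dualLattice l).toAddSubgroup.subtype
  have hfin : Finite (dualLattice l ⧸ C) := by
    have : AddGroup.FG (dualLattice l ⧸ C) := QuotientAddGroup.fg C
    refine AddCommGroup.finite_of_fg_isAddTorsion _ fun q => ?_
    obtain ⟨x, rfl⟩ := QuotientAddGroup.mk_surjective q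
    rw [isOfFinAddOrder_iff_nsmul_eq_zero]
    obtain ⟨n, hn, o, ho⟩ := exists_nsmul_eq_coe (x : K)
    exact ⟨n, hn, (QuotientAddGroup.eq_zero_iff _).2 ⟨o, ho.symm⟩⟩
  refine ⟨Nat.card (dualLattice l ⧸ C), Nat.card_pos, fun y hy => ?_⟩
  have h1 : Nat.card (dualLattice l ⧸ C) • (⟨y, hy⟩ : dualLattice l) ∈ C := by
    rw [← QuotientAddGroup.eq_zero_iff, QuotientAddGroup.mk_nsmul, card_nsmul_eq_zero']
  obtain ⟨o, ho⟩ := h1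
  exact ⟨o, ho.symm⟩

/-- The elements of `𝓞 K` that multiply the dual lattice into `𝓞 K`. -/
def dualConductor (l : K →ₗ[ℚ] ℚ) : Ideal (𝓞 K) where
  carrier := {x | ∀ y ∈ dualLattice l, ∃ o : 𝓞 K, x * y = o}
  zero_mem' y _ := ⟨0, by simp⟩
  add_mem' hx hx' y hy := by
    obtain ⟨o, ho⟩ := hx y hy
    obtain ⟨o', ho'⟩ := hx' y hy
    exact ⟨o + o', by rw [coe_add_ringOfIntegers, coe_add_ringOfIntegers, add_mul, ho, ho']⟩
  smul_mem' c x hx y hy := by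
    obtain ⟨o, ho⟩ := hx y hy
    exact ⟨c * o, by rw [smul_eq_mul, coe_mul_ringOfIntegers, coe_mul_ringOfIntegers, mul_assoc, ho]⟩

theorem dualConductor_ne_bot (hl0 : l ≠ 0) : dualConductor l ≠ ⊥ := by
  obtain ⟨n, hn, h⟩ := exists_nsmul_dualLattice hl0
  have h1 : (n : 𝓞 K) ∈ dualConductor l := fun y hy => by
    obtain ⟨o, ho⟩ := h y hy
    exact ⟨o, by rw [← ho, nsmul_eq_mul]; simp⟩
  intro h0
  rw [h0, Ideal.mem_bot] at h1
  exact hn.ne' (by exact_mod_cast h1)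

theorem dvd_of_mul_dualLattice_eq (hl : ∀ x : 𝓞 K, l x ∈ ratInt) {a : 𝓞 K} (ha0 : a ≠ 0)
    (ha : (Ideal.span {a}).IsMaximal) (hla : l (a : K)⁻¹ ∉ ratInt) {y : K} (hy : y ∈ dualLattice l)
    {o : 𝓞 K} (ho : a * y = o) : a ∣ o := by
  have ha' : (a : K) ≠ 0 := by simpa using ha0
  by_contra h
  rw [← Ideal.mem_span_singleton] at h
  obtain ⟨v, i, hi, hv⟩ := ha.exists_inv h
  obtain ⟨u, rfl⟩ := Ideal.mem_span_singleton.1 hi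
  refine hla ?_
  have h1 : (a : K)⁻¹ = y * v + u := by
    have h2 := congrArg (fun x : 𝓞 K => (x : K)) hv
    simp only [coe_add_ringOfIntegers, coe_mul_ringOfIntegers, ← ho] at h2
    have h3 : ((1 : 𝓞 K) : K) = 1 := map_one _
    rw [h3] at h2
    field_simp
    linear_combination -h2
  rw [h1, map_add]
  exact ratInt.add_mem (hy v) (hl u)

theorem isCoprime_dualConductor (hl : ∀ x : 𝓞 K, l x ∈ ratInt) {a : 𝓞 K} (ha0 : a ≠ 0)
    (ha : (Ideal.span {a}).IsMaximal) (hla : l (a : K)⁻¹ ∉ ratInt) :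
    IsCoprime (Ideal.span {a}) (dualConductor l) := by
  have hl0 : l ≠ 0 := by rintro rfl; exact hla (by simp [ratInt.zero_mem])
  by_contra h
  have h1 : dualConductor l ≤ Ideal.span {a} := by
    by_contra h2
    exact h (Ideal.isCoprime_iff_sup_eq.2 (ha.1.2 _ (left_lt_sup.2 h2)))
  have h2 : dualConductor l ≤ Ideal.span {a} • dualConductor l := fun n hn => by
    obtain ⟨x, rfl⟩ := Ideal.mem_span_singleton.1 (h1 hn)
    refine Submodule.smul_mem_smul (Ideal.mem_span_singleton_self a) fun y hy => ?_
    obtain ⟨o, ho⟩ := hn y hy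
    rw [coe_mul_ringOfIntegers, mul_assoc] at ho
    have hxy : (x : K) * y ∈ dualLattice l := (dualLattice l).smul_mem x hy
    obtain ⟨o', rfl⟩ := dvd_of_mul_dualLattice_eq hl ha0 ha hla hxy ho
    rw [coe_mul_ringOfIntegers] at ho
    exact ⟨o', mul_left_cancel₀ (by simpa using ha0) ho⟩
  obtain ⟨r, hr, hr'⟩ := Submodule.exists_sub_one_mem_and_smul_eq_zero_of_fg_of_le_smul _ _
    (IsNoetherian.noetherian (dualConductor l)) h2
  obtain ⟨n, hn, hn0⟩ := Submodule.exists_mem_ne_zero_of_ne_bot (dualConductor_ne_bot hl0)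
  rw [(mul_eq_zero.1 (hr' n hn)).resolve_right hn0, zero_sub, neg_mem_iff] at hr
  exact ha.ne_top ((Ideal.eq_top_iff_one _).2 hr)

end Lattice

section DualGaussSum

variable {K : Type*} [Field K] [NumberField K] {l : K →ₗ[ℚ] ℚ}

theorem map_nsmul_add_sq (κ x y : K) (N : ℕ) :
    l (κ * ((x + N • y) * (x + N • y))) - l (κ * (x * x)) =
      2 * l (N • κ * (x * y)) + N * l (N • κ * (y * y)) := by
  have l2 (c : ℕ) (x : K) : l (c * x) = c * l x := by rw [← nsmul_eq_mul, map_nsmul, nsmul_eq_mul]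
  have l2' (x : K) : l (2 * x) = 2 * l x := l2 2 x
  rw [← l2, ← l2', ← map_sub, ← map_add]
  congr 1
  simp only [nsmul_eq_mul]
  ring

theorem exists_hasMean_dualLattice (hl0 : l ≠ 0) (κ : K) :
    ∃ m, HasMean (fun x : dualLattice l => expQ (l (κ * (x * x)))) m := by
  have := dualLattice_fg hl0
  obtain ⟨n, hn, hn'⟩ := exists_nsmul_dualLattice hl0
  obtain ⟨k, hk, o, ho⟩ := exists_nsmul_eq_coe κ
  refine exists_hasMean (Nat.mul_pos hn hk) fun x y => expQ_congr ?_
  have key (x y : dualLattice l) : l ((n * k) • κ * (x * y)) ∈ ratInt := by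
    obtain ⟨o', ho'⟩ := hn' x x.2
    have h1 : ((n * k) • κ * (x * y) : K) = y * (o * o' : 𝓞 K) := by
      rw [coe_mul_ringOfIntegers, ← ho, ← ho']
      simp only [nsmul_eq_mul]
      push_cast
      ring
    rw [h1]
    exact y.2 _
  change l (κ * ((x + (n * k) • (y : K)) * (x + (n * k) • (y : K)))) - _ ∈ _
  rw [map_nsmul_add_sq]
  exact ratInt.add_mem (mul_mem_ratInt (intCast_mem_ratInt 2) (key x y))
    (mul_mem_ratInt (intCast_mem_ratInt (n * k : ℕ)) (key y y))

theorem exists_hasMean_ringOfIntegers (hl : ∀ x : 𝓞 K, l x ∈ ratInt) (κ : K) :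
    ∃ m, HasMean (fun x : 𝓞 K => expQ (l (κ * (x * x)))) m := by
  have : AddGroup.FG (𝓞 K) := Module.Finite.iff_addGroup_fg.1 inferInstance
  obtain ⟨k, hk, o, ho⟩ := exists_nsmul_eq_coe κ
  refine exists_hasMean hk fun x y => expQ_congr ?_
  have key (x y : 𝓞 K) : l (k • κ * (x * y)) ∈ ratInt := by
    rw [ho, ← coe_mul_ringOfIntegers, ← coe_mul_ringOfIntegers]
    exact hl _
  have h1 : ((x + k • y : 𝓞 K) : K) = x + k • (y : K) := by
    rw [coe_add_ringOfIntegers]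
    congr 1
  rw [h1, map_nsmul_add_sq]
  exact ratInt.add_mem (mul_mem_ratInt (intCast_mem_ratInt 2) (key x y))
    (mul_mem_ratInt (intCast_mem_ratInt k) (key y y))

/-- Multiplicativity of Gauss sums. -/
theorem HasMean.eq_mul_of_isCoprime (hl : ∀ x : 𝓞 K, l x ∈ ratInt) {p s r : 𝓞 K} {κ κ₁ κ₂ : K}
    (hκ : 4 * κ * p * s = r) (hκ₁ : κ₁ = κ * p ^ 2) (hκ₂ : κ₂ = κ * (2 * s) ^ 2)
    (hco : IsCoprime p (2 * s)) (hp : IsCoprime (Ideal.span {p}) (dualConductor l)) {m m₁ m₂ : ℂ}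
    (h : HasMean (fun x : dualLattice l => expQ (l (κ * (x * x)))) m)
    (h₁ : HasMean (fun x : dualLattice l => expQ (l (κ₁ * (x * x)))) m₁)
    (h₂ : HasMean (fun x : 𝓞 K => expQ (l (κ₂ * (x * x)))) m₂) : m = m₁ * m₂ := by
  have h2 : ((2 : 𝓞 K) : K) = 2 := map_ofNat _ 2
  have h1 : ((1 : 𝓞 K) : K) = 1 := map_one _
  let φ : dualLattice l × 𝓞 K →+ dualLattice l := AddMonoidHom.mk'
    (fun q => p • q.1 + ⟨(2 * s * q.2 : 𝓞 K), coe_mem_dualLattice hl _⟩) (by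
      intro q q'
      ext
      change (p : K) * (q.1 + q'.1) + (2 * s * (q.2 + q'.2) : 𝓞 K) =
        p * q.1 + (2 * s * q.2 : 𝓞 K) + (p * q'.1 + (2 * s * q'.2 : 𝓞 K))
      simp only [coe_mul_ringOfIntegers, coe_add_ringOfIntegers]
      ring)
  have hφ (q) : (φ q : K) = p * q.1 + 2 * s * q.2 := by
    change (p : K) * q.1 + (2 * s * q.2 : 𝓞 K) = _
    rw [coe_mul_ringOfIntegers, coe_mul_ringOfIntegers, h2]
  refine (h.comp_of_surjective φ fun y => ?_).unique ((h₁.prod h₂).congr fun q => ?_)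
  · obtain ⟨_, hi, n, hn, hin⟩ := Ideal.isCoprime_iff_exists.1 hp
    obtain ⟨u, rfl⟩ := Ideal.mem_span_singleton.1 hi
    obtain ⟨o, ho⟩ := hn y y.2
    obtain ⟨v, w, hvw⟩ := hco
    refine ⟨(u • y + ⟨(o * v : 𝓞 K), coe_mem_dualLattice hl _⟩, o * w), Subtype.ext ?_⟩
    rw [hφ]
    change p * ((u : K) * y + (o * v : 𝓞 K)) + 2 * s * (o * w : 𝓞 K) = (y : K)
    have h3 := congrArg (fun x : 𝓞 K => (x : K)) hin
    have h4 := congrArg (fun x : 𝓞 K => (x : K)) hvw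
    simp only [coe_mul_ringOfIntegers, coe_add_ringOfIntegers, h1, h2] at h3 h4 ⊢
    linear_combination (y : K) * h3 - ho + o * h4
  · rw [← expQ_add]
    refine (expQ_congr ?_).symm
    rw [hφ, ← map_add, ← map_sub]
    convert q.1.2 (r * q.2) using 2
    rw [coe_mul_ringOfIntegers, hκ₁, hκ₂, ← hκ]
    ring

theorem hasMean_isometry (hl : ∀ x : 𝓞 K, l x ∈ ratInt) {a b x y : 𝓞 K}
    (hxy : a * x ^ 2 + b * y ^ 2 - 1 ∈ Ideal.span {4} * dualConductor l) {m₁ ma mb mab : ℂ}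
    (h₁ : HasMean (fun x : dualLattice l => expQ (l (1 / 4 * (x * x)))) m₁)
    (ha : HasMean (fun x : dualLattice l => expQ (l (a / 4 * (x * x)))) ma)
    (hb : HasMean (fun x : dualLattice l => expQ (l (b / 4 * (x * x)))) mb)
    (hab : HasMean (fun x : dualLattice l => expQ (l (a * b / 4 * (x * x)))) mab) :
    ma * mb = m₁ * mab := by
  have h4 : ((4 : 𝓞 K) : K) = 4 := map_ofNat _ 4
  have h1 : ((1 : 𝓞 K) : K) = 1 := map_one _
  obtain ⟨n, hn, hn'⟩ := Ideal.mem_span_singleton_mul.1 hxy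
  have hD : (a * x ^ 2 + b * y ^ 2 : K) = 1 + 4 * n := by
    have h3 := congrArg (fun x : 𝓞 K => (x : K)) (add_eq_of_eq_sub hn')
    simp only [coe_mul_ringOfIntegers, coe_add_ringOfIntegers, h1, h4, sq] at h3 ⊢
    rw [← h3]; ring
  have period (c o : 𝓞 K) (X : dualLattice l) {Y : dualLattice l} (hY : (Y : K) = 4 * o) :
      expQ (l (c / 4 * ((X + Y : dualLattice l) * (X + Y : dualLattice l)))) =
        expQ (l (c / 4 * (X * X))) := by
    refine expQ_congr ?_
    rw [← map_sub]
    convert ratInt.add_mem (X.2 (2 * c * o)) (hl (4 * c * o * o)) using 1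
    rw [← map_add]
    congr 1
    have h2 : ((2 : 𝓞 K) : K) = 2 := map_ofNat _ 2
    simp only [coe_mul_ringOfIntegers, h2, h4, Submodule.coe_add, hY]
    ring
  let φ : dualLattice l × dualLattice l →+ dualLattice l × dualLattice l := AddMonoidHom.mk'
    (fun q => (x • q.1 - (b * y) • q.2, y • q.1 + (a * x) • q.2)) (by
      intro q q'
      ext1 <;> simp only [Prod.fst_add, Prod.snd_add, smul_add] <;> abel)
  have hφ1 (q) : ((φ q).1 : K) = x * q.1 - b * y * q.2 := by
    rw [← coe_mul_ringOfIntegers]; rfl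
  have hφ2 (q) : ((φ q).2 : K) = y * q.1 + a * x * q.2 := by
    rw [← coe_mul_ringOfIntegers]; rfl
  refine ((ha.prod hb).comp φ fun q => ?_).unique ((h₁.prod hab).congr fun q => ?_)
  · obtain ⟨o, ho⟩ := hn q.1 q.1.2
    obtain ⟨o', ho'⟩ := hn q.2 q.2.2
    refine ⟨((a * x) • q.1 + (b * y) • q.2, -(y • q.1) + x • q.2), fun z => ?_⟩
    set w : dualLattice l × dualLattice l := ((a * x) • q.1 + (b * y) • q.2, -(y • q.1) + x • q.2)
    have hw1 : (w.1 : K) = a * x * q.1 + b * y * q.2 := by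
      rw [← coe_mul_ringOfIntegers, ← coe_mul_ringOfIntegers]; rfl
    have hw2 : (w.2 : K) = -(y * q.1) + x * q.2 := rfl
    have hd1 : ((φ w - q).1 : K) = 4 * o := by
      change ((φ w).1 : K) - q.1 = _
      rw [hφ1, hw1, hw2, ← ho]
      linear_combination (q.1 : K) * hD
    have hd2 : ((φ w - q).2 : K) = 4 * o' := by
      change ((φ w).2 : K) - q.2 = _
      rw [hφ2, hw1, hw2, ← ho']
      linear_combination (q.2 : K) * hD
    have hz : z + φ w = z + q + (φ w - q) := by abel
    rw [hz, Prod.fst_add (z + q), Prod.snd_add (z + q), period a o _ hd1, period b o' _ hd2]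
  · rw [← expQ_add, ← expQ_add]
    refine (expQ_congr ?_).symm
    rw [← map_add, ← map_add, ← map_sub]
    obtain ⟨o, ho⟩ := hn q.1 q.1.2
    obtain ⟨o', ho'⟩ := hn q.2 q.2.2
    convert ratInt.add_mem (q.1.2 o) (q.2.2 (a * b * o')) using 1
    rw [← map_add]
    congr 1
    rw [coe_mul_ringOfIntegers, coe_mul_ringOfIntegers, hφ1, hφ2, ← ho, ← ho']
    linear_combination (q.1 * q.1 + a * b * q.2 * q.2) / 4 * hD

end DualGaussSum

section Reciprocity

theorem isCoprime_two_of_dvd_sub_one {R : Type*} [CommRing R] {a : R} (h : 2 ∣ a - 1) :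
    IsCoprime a 2 := by
  obtain ⟨r, hr⟩ := h
  exact ⟨1, -r, by linear_combination hr⟩

theorem two_notMem_span_singleton {R : Type*} [CommRing R] {a : R} (ha : (Ideal.span {a}).IsPrime)
    (h : 2 ∣ a - 1) : (2 : R) ∉ Ideal.span {a} := fun h2 => by
  obtain ⟨u, v, huv⟩ := isCoprime_two_of_dvd_sub_one h
  refine ha.ne_top ((Ideal.eq_top_iff_one _).2 ?_)
  rw [← huv]
  exact add_mem (Ideal.mul_mem_left _ _ (Ideal.mem_span_singleton_self a)) (Ideal.mul_mem_left _ _ h2)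

theorem isUnit_mk_of_isCoprime {R : Type*} [CommRing R] {a : R} {I : Ideal R}
    (h : IsCoprime (Ideal.span {a}) I) : IsUnit (Ideal.Quotient.mk I a) := by
  obtain ⟨_, hi, n, hn, hin⟩ := Ideal.isCoprime_iff_exists.1 h
  obtain ⟨u, rfl⟩ := Ideal.mem_span_singleton.1 hi
  refine IsUnit.of_mul_eq_one (Ideal.Quotient.mk I u) ?_
  rw [← map_mul, ← map_one (Ideal.Quotient.mk I), ← hin, map_add,
    Ideal.Quotient.eq_zero_iff_mem.2 hn, add_zero]

variable {K : Type*} [Field K] [NumberField K] {l : K →ₗ[ℚ] ℚ}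

theorem hasMean_ringOfIntegers_mul (hl : ∀ x : 𝓞 K, l x ∈ ratInt) {a b : 𝓞 K} (ha0 : a ≠ 0)
    (ha : (Ideal.span {a}).IsMaximal) (hla : l (a : K)⁻¹ ∉ ratInt) (ha2 : 2 ∣ a - 1)
    (hb : b ∉ Ideal.span {a}) {m m' : ℂ}
    (h : HasMean (fun x : 𝓞 K => expQ (l ((a : K)⁻¹ * (x * x)))) m)
    (h' : HasMean (fun x : 𝓞 K => expQ (l (b * (a : K)⁻¹ * (x * x)))) m') :
    m' = propSign (∃ u, b - u ^ 2 ∈ Ideal.span {a}) * m := by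
  have ha' : (a : K) ≠ 0 := by simpa using ha0
  have h1 : ((1 : 𝓞 K) : K) = 1 := map_one _
  have : Finite (𝓞 K ⧸ Ideal.span {a}) :=
    Ideal.finiteQuotientOfFreeOfNeBot _ (by simpa using ha0)
  refine HasMean.mul_sq_of_isMaximal ha (two_notMem_span_singleton ha.isPrime ha2)
    (f := fun x => expQ (l ((a : K)⁻¹ * x))) (fun x y => ?_) (fun x hx => ?_) ⟨1, ?_⟩ hb
    (h.congr fun x => ?_) (h'.congr fun x => ?_)
  · rw [coe_add_ringOfIntegers, mul_add, map_add, expQ_add]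
  · obtain ⟨u, rfl⟩ := Ideal.mem_span_singleton.1 hx
    rw [coe_mul_ringOfIntegers, inv_mul_cancel_left₀ ha', expQ_eq_one_iff]
    exact hl u
  · rwa [h1, mul_one, Ne, expQ_eq_one_iff]
  · rw [sq, coe_mul_ringOfIntegers]
  · rw [sq, coe_mul_ringOfIntegers, coe_mul_ringOfIntegers, mul_comm (b : K), mul_assoc]

/-- **Quadratic reciprocity** for primary elements, one of them totally positive and congruent
to `1` modulo `8`. -/
theorem quadratic_reciprocity {a b : 𝓞 K} (hap : (Ideal.span {a}).IsPrime)
    (ha0 : Ideal.span {a} ≠ ⊥) (hbp : (Ideal.span {b}).IsPrime) (hb0 : Ideal.span {b} ≠ ⊥)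
    (hab : Ideal.span {a} ≠ Ideal.span {b}) (ha8 : 8 ∣ a - 1)
    (hapos : ∀ σ : K →+* ℝ, 0 < σ a) (hb2 : 2 ∣ b - 1) :
    (∃ u, b - u ^ 2 ∈ Ideal.span {a}) ↔ ∃ u, a - u ^ 2 ∈ Ideal.span {b} := by
  have ha := hap.isMaximal ha0
  have hb := hbp.isMaximal hb0
  have ha2 : 2 ∣ a - 1 := (Dvd.intro 4 (by norm_num)).trans ha8
  replace ha0 : a ≠ 0 := by simpa using ha0
  replace hb0 : b ≠ 0 := by simpa using hb0
  have ha' : (a : K) ≠ 0 := by simpa using ha0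
  have hb' : (b : K) ≠ 0 := by simpa using hb0
  have h1 : ((1 : 𝓞 K) : K) = 1 := map_one _
  have hba : b ∉ Ideal.span {a} := fun h =>
    hab (hb.eq_of_le hap.ne_top ((Ideal.span_singleton_le_iff_mem _).2 h)).symm
  have hab' : a ∉ Ideal.span {b} := fun h =>
    hab (ha.eq_of_le hbp.ne_top ((Ideal.span_singleton_le_iff_mem _).2 h))
  have hcop : IsCoprime a b :=
    (Ideal.isCoprime_span_singleton_iff _ _).1 (Ideal.isCoprime_of_isMaximal hab)
  obtain ⟨l, hl, hla, hlb⟩ := exists_map_inv_not_mem_ratInt₂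
    (mt Ideal.span_singleton_eq_top.2 hap.ne_top) ha0
    (mt Ideal.span_singleton_eq_top.2 hbp.ne_top) hb0
  have hl0 : l ≠ 0 := by rintro rfl; exact hla (by simp [ratInt.zero_mem])
  have hac := isCoprime_dualConductor hl ha0 ha hla
  have hbc := isCoprime_dualConductor hl hb0 hb hlb
  have h4 : (Ideal.span {4} : Ideal (𝓞 K)) = Ideal.span {2} * Ideal.span {2} := by
    rw [Ideal.span_singleton_mul_span_singleton]; norm_num
  have hcop4 {c : 𝓞 K} (hc : 2 ∣ c - 1) (hcc : IsCoprime (Ideal.span {c}) (dualConductor l)) :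
      IsCoprime (Ideal.span {c}) (Ideal.span {4} * dualConductor l) := by
    have h2 := (Ideal.isCoprime_span_singleton_iff _ _).2 (isCoprime_two_of_dvd_sub_one hc)
    rw [h4]
    exact (h2.mul_right h2).mul_right hcc
  have hfin : Finite (𝓞 K ⧸ (Ideal.span {4} * dualConductor l)) := by
    refine Ideal.finiteQuotientOfFreeOfNeBot _ (mul_ne_zero ?_ (dualConductor_ne_bot hl0))
    simp
  obtain ⟨x, y, hxy⟩ := exists_quadratic_form_sub_one_mem (isUnit_mk_of_isCoprime (hcop4 ha2 hac))
    (isUnit_mk_of_isCoprime (hcop4 hb2 hbc)) ha8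
  obtain ⟨t1, ht1⟩ := exists_hasMean_dualLattice hl0 (1 / 4)
  obtain ⟨ta, hta⟩ := exists_hasMean_dualLattice hl0 (a / 4)
  obtain ⟨tb, htb⟩ := exists_hasMean_dualLattice hl0 (b / 4)
  obtain ⟨tab, htab⟩ := exists_hasMean_dualLattice hl0 (a * b / 4)
  obtain ⟨h1', hh1⟩ := exists_hasMean_dualLattice hl0 (4 * (1 : 𝓞 K))⁻¹
  obtain ⟨ha1, hha⟩ := exists_hasMean_dualLattice hl0 (4 * ((1 : 𝓞 K) * a))⁻¹
  obtain ⟨hb1, hhb⟩ := exists_hasMean_dualLattice hl0 (4 * b)⁻¹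
  obtain ⟨hab1, hhab⟩ := exists_hasMean_dualLattice hl0 (4 * (b * a))⁻¹
  obtain ⟨ma, hma⟩ := exists_hasMean_dualLattice hl0 (a * (4 * b : K)⁻¹)
  obtain ⟨ga, hga⟩ := exists_hasMean_ringOfIntegers hl (a : K)⁻¹
  obtain ⟨gb, hgb⟩ := exists_hasMean_ringOfIntegers hl (b : K)⁻¹
  obtain ⟨gab, hgab⟩ := exists_hasMean_ringOfIntegers hl (b * (a : K)⁻¹)
  obtain ⟨gba, hgba⟩ := exists_hasMean_ringOfIntegers hl (a * (b : K)⁻¹)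
  have e1 := hasMean_isometry hl hxy ht1 hta htb htab
  have e2 : h1' = t1 := hh1.unique (ht1.congr fun x => by rw [h1]; norm_num)
  have ca : IsCoprime a (2 * 1) := by rw [mul_one]; exact isCoprime_two_of_dvd_sub_one ha2
  have cb : IsCoprime b (2 * 1) := by rw [mul_one]; exact isCoprime_two_of_dvd_sub_one hb2
  have e3 : ha1 = ta * ga := HasMean.eq_mul_of_isCoprime hl (p := a) (s := 1) (r := 1)
    (by rw [h1]; field_simp) (by rw [h1]; field_simp) (by rw [h1]; field_simp; norm_num)
    ca hac hha hta hga
  have e4 : hb1 = tb * gb := HasMean.eq_mul_of_isCoprime hl (p := b) (s := 1) (r := 1)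
    (by rw [h1]; field_simp) (by field_simp) (by rw [h1]; field_simp; norm_num)
    cb hbc hhb htb hgb
  have e5 : hab1 = ma * gab := HasMean.eq_mul_of_isCoprime hl (p := a) (s := b) (r := 1)
    (by rw [h1]; field_simp) (by field_simp) (by field_simp; norm_num)
    ((isCoprime_two_of_dvd_sub_one ha2).mul_right hcop) hac hhab hma hgab
  have e6 : ma = tab * gba := HasMean.eq_mul_of_isCoprime hl (p := b) (s := 1) (r := a)
    (by rw [h1]; field_simp) (by field_simp) (by rw [h1]; field_simp; norm_num)
    cb hbc hma htab hgba
  have e7 := hasMean_ringOfIntegers_mul hl ha0 ha hla ha2 hba hga hgab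
  have e8 := hasMean_ringOfIntegers_mul hl hb0 hb hlb hb2 hab' hgb hgba
  obtain ⟨n1, r, hr, e9⟩ := hasMean_mul_totally_positive hl hl0 one_ne_zero ha0 hapos hh1 hha
  obtain ⟨n2, r', hr', e10⟩ := hasMean_mul_totally_positive hl hl0 hb0 ha0 hapos hhb hhab
  set ε := propSign (∃ u, b - u ^ 2 ∈ Ideal.span {a})
  set δ := propSign (∃ u, a - u ^ 2 ∈ Ideal.span {b})
  have key : (r' : ℂ) = (ε * δ) * r := by
    apply mul_right_cancel₀ (mul_ne_zero n1 n2)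
    calc (r' : ℂ) * (h1' * hb1) = h1' * hab1 := by rw [e10]; ring
      _ = ε * δ * (ga * gb * (t1 * tab)) := by rw [e2, e5, e6, e7, e8]; ring
      _ = ε * δ * (ha1 * hb1) := by rw [← e1, e3, e4]; ring
      _ = _ := by rw [e9]; ring
  have key' : r' = ε * δ * r := by exact_mod_cast key
  exact iff_of_propSign_mul_pos (pos_of_mul_pos_left (key' ▸ hr') hr.le)

theorem FiniteField.isSquare_mul_of_not_isSquare {F : Type*} [Field F] [Finite F] {x y : F}
    (hx : ¬ IsSquare x) (hy : ¬ IsSquare y) : IsSquare (x * y) := by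
  classical
  have : Fintype F := Fintype.ofFinite F
  have hx0 : x ≠ 0 := by rintro rfl; exact hx (IsSquare.zero)
  have hy0 : y ≠ 0 := by rintro rfl; exact hy (IsSquare.zero)
  rw [← quadraticChar_one_iff_isSquare (mul_ne_zero hx0 hy0), map_mul,
    quadraticChar_neg_one_iff_not_isSquare.2 hx, quadraticChar_neg_one_iff_not_isSquare.2 hy]
  norm_num

end Reciprocity

/-- Consequences of the choice of parameters (§3): `a` is a square mod `(b)`, `a` is not a
square mod `(c)`, and `b·c·e` is a square mod `(a)`. -/
theorem stmt_4 (K : Type*) [Field K] [NumberField K]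
    (a b c e : 𝓞 K)
    (hap : (Ideal.span {a} : Ideal (𝓞 K)).IsPrime) (ha0 : Ideal.span {a} ≠ (⊥ : Ideal (𝓞 K)))
    (hbp : (Ideal.span {b} : Ideal (𝓞 K)).IsPrime) (hb0 : Ideal.span {b} ≠ (⊥ : Ideal (𝓞 K)))
    (hcp : (Ideal.span {c} : Ideal (𝓞 K)).IsPrime) (hc0 : Ideal.span {c} ≠ (⊥ : Ideal (𝓞 K)))
    (hep : (Ideal.span {e} : Ideal (𝓞 K)).IsPrime) (he0 : Ideal.span {e} ≠ (⊥ : Ideal (𝓞 K)))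
    (hdist : ([Ideal.span {a}, Ideal.span {b}, Ideal.span {c}, Ideal.span {e}] :
      List (Ideal (𝓞 K))).Pairwise (· ≠ ·))
    (ha8 : (8 : 𝓞 K) ∣ a - 1) (hapos : ∀ σ : K →+* ℝ, 0 < σ (algebraMap (𝓞 K) K a))
    (hb : (2 * a) ∣ b - 1)
    (hc2 : (2 : 𝓞 K) ∣ c - 1) (hc : ¬ ∃ u : 𝓞 K, c - u ^ 2 ∈ (Ideal.span {a} : Ideal (𝓞 K)))
    (he : ¬ ∃ u : 𝓞 K, e - u ^ 2 ∈ (Ideal.span {a} : Ideal (𝓞 K))) :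
    (∃ u : 𝓞 K, a - u ^ 2 ∈ (Ideal.span {b} : Ideal (𝓞 K))) ∧
      (¬ ∃ u : 𝓞 K, a - u ^ 2 ∈ (Ideal.span {c} : Ideal (𝓞 K))) ∧
      (∃ u : 𝓞 K, b * c * e - u ^ 2 ∈ (Ideal.span {a} : Ideal (𝓞 K))) := by
  simp only [List.pairwise_cons, List.mem_cons, forall_eq_or_imp] at hdist
  obtain ⟨⟨hab, hac, -⟩, -⟩ := hdist
  have hba : b - 1 ∈ (Ideal.span {a} : Ideal (𝓞 K)) :=
    Ideal.mem_span_singleton.2 ((Dvd.intro_left 2 rfl).trans hb)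
  refine ⟨?_, ?_, ?_⟩
  · exact (quadratic_reciprocity hap ha0 hbp hb0 hab ha8 hapos
      ((Dvd.intro a rfl).trans hb)).1 ⟨1, by rwa [one_pow]⟩
  · exact fun h => hc ((quadratic_reciprocity hap ha0 hcp hc0 hac ha8 hapos hc2).2 h)
  · have hmax := hap.isMaximal ha0
    let _ := Ideal.Quotient.field (Ideal.span {a})
    have : Finite (𝓞 K ⧸ Ideal.span {a}) := Ideal.finiteQuotientOfFreeOfNeBot _ ha0
    rw [← isSquare_mk_iff] at hc he ⊢
    have h1 := FiniteField.isSquare_mul_of_not_isSquare hc he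
    rw [map_mul, map_mul, Ideal.Quotient.mk_eq_mk_iff_sub_mem _ _ |>.2 hba, map_one, one_mul]
    exact h1
end

section
/- Let K be a number field with ring of integers O_K, and let c, e ∈ O_K be elements generating two distinct prime ideals of O_K. Then c² − c·e is not the square of any element of K. -/
open NumberField

/-- If `c, e ∈ 𝓞 K` generate two distinct prime ideals, then `D = c² - c·e` is not a square
in `K`. -/
theorem stmt_5 (K : Type*) [Field K] [NumberField K]
    (c e : 𝓞 K)
    (hcp : (Ideal.span {c} : Ideal (𝓞 K)).IsPrime) (hc0 : Ideal.span {c} ≠ (⊥ : Ideal (𝓞 K)))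
    (hep : (Ideal.span {e} : Ideal (𝓞 K)).IsPrime) (he0 : Ideal.span {e} ≠ (⊥ : Ideal (𝓞 K)))
    (hce : Ideal.span {c} ≠ (Ideal.span {e} : Ideal (𝓞 K))) :
    ¬ ∃ x : K, x ^ 2 = algebraMap (𝓞 K) K (c ^ 2 - c * e) := by
  rintro ⟨x, hx⟩
  have hc : Prime c :=
    (Ideal.span_singleton_prime (mt Ideal.span_singleton_eq_bot.mpr hc0)).mp hcp
  have he : Prime e :=
    (Ideal.span_singleton_prime (mt Ideal.span_singleton_eq_bot.mpr he0)).mp hep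
  have hint : IsIntegral (𝓞 K) (x ^ 2) := hx ▸ isIntegral_algebraMap
  obtain ⟨y, rfl⟩ := IsIntegrallyClosed.exists_algebraMap_eq_of_isIntegral_pow two_pos hint
  rw [← map_pow] at hx
  have hy : y ^ 2 = c ^ 2 - c * e := FaithfulSMul.algebraMap_injective (𝓞 K) K hx
  obtain ⟨z, rfl⟩ : c ∣ y := hc.dvd_of_dvd_pow ⟨c - e, by rw [hy]; ring⟩
  have hz : c * z ^ 2 = c - e := mul_left_cancel₀ hc.ne_zero (by linear_combination hy)
  have hdvd : c ∣ e := ⟨1 - z ^ 2, by linear_combination hz⟩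
  exact hce (Ideal.span_singleton_eq_span_singleton.mpr (hc.associated_of_dvd he hdvd))
end

section
/- Let K be a number field with ring of integers O_K, let c, e ∈ O_K be elements generating two distinct prime ideals of O_K, let D = c² − c·e, and let v be the prime ideal (c) of O_K. Then the polynomial X² − D is irreducible over the v-adic completion K_v of K. -/
open NumberField IsDedekindDomain Polynomial

theorem WithZero.sq_ne_exp_neg_one (y : WithZero (Multiplicative ℤ)) :
    y ^ 2 ≠ WithZero.exp (-1 : ℤ) := by
  intro h
  have hy : y ≠ 0 := by
    rintro rfl
    rw [zero_pow two_ne_zero] at h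
    exact WithZero.exp_ne_zero h.symm
  have hlog := congrArg WithZero.log h
  rw [WithZero.log_pow, WithZero.log_exp, nsmul_eq_mul] at hlog
  push_cast at hlog
  omega

theorem IsDedekindDomain.HeightOneSpectrum.irreducible_X_sq_sub_C {R K : Type*} [CommRing R]
    [IsDedekindDomain R] [Field K] [Algebra R K] [IsFractionRing R K] (v : HeightOneSpectrum R)
    {d : v.adicCompletion K} (hd : Valued.v d = WithZero.exp (-1 : ℤ)) :
    Irreducible (X ^ 2 - C d : (v.adicCompletion K)[X]) := by
  refine X_pow_sub_C_irreducible_of_prime Nat.prime_two fun b hb => ?_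
  refine WithZero.sq_ne_exp_neg_one (Valued.v b) ?_
  rw [← map_pow, hb, hd]

/-- If `c, e ∈ 𝓞 K` generate two distinct prime ideals, `D = c² - c·e` and `v = (c)`, then
`X² - D` is irreducible over the `v`-adic completion `K_v` of `K`. -/
theorem stmt_7 (K : Type*) [Field K] [NumberField K]
    (c e : 𝓞 K)
    (hcp : (Ideal.span {c} : Ideal (𝓞 K)).IsPrime) (hc0 : Ideal.span {c} ≠ (⊥ : Ideal (𝓞 K)))
    (hep : (Ideal.span {e} : Ideal (𝓞 K)).IsPrime) (he0 : Ideal.span {e} ≠ (⊥ : Ideal (𝓞 K)))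
    (hce : Ideal.span {c} ≠ (Ideal.span {e} : Ideal (𝓞 K)))
    (v : HeightOneSpectrum (𝓞 K)) (hv : v.asIdeal = Ideal.span {c}) :
    Irreducible (X ^ 2 -
      C (algebraMap (𝓞 K) (v.adicCompletion K) (c ^ 2 - c * e)) :
        (v.adicCompletion K)[X]) := by
  have hc : c ≠ 0 := by simpa using hc0
  have hcv : c ∈ v.asIdeal := hv ▸ Ideal.mem_span_singleton_self c
  have hev : e ∉ v.asIdeal := fun he => by
    have hle : Ideal.span {e} ≤ (Ideal.span {c} : Ideal (𝓞 K)) := by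
      rwa [Ideal.span_singleton_le_iff_mem, ← hv]
    exact hce ((hep.isMaximal he0).eq_of_le hcp.ne_top hle).symm
  have hsub : v.intValuation (c - e) = 1 := by
    rw [HeightOneSpectrum.intValuation_eq_one_iff]
    exact fun h => hev ((Submodule.sub_mem_iff_right _ hcv).1 h)
  refine v.irreducible_X_sq_sub_C ?_
  have hD : Valued.v (algebraMap (𝓞 K) (v.adicCompletion K) (c ^ 2 - c * e)) =
      v.valuation K (algebraMap (𝓞 K) K (c ^ 2 - c * e)) :=
    v.valuedAdicCompletion_eq_valuation _
  rw [hD, v.valuation_of_algebraMap, show c ^ 2 - c * e = c * (c - e) by ring, map_mul, hsub,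
    v.intValuation_singleton hc hv, mul_one]
end
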